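/- arXiv:2108.03664 — 3 statements merged into one kernel-verified Lean document; each statement's English description precedes it below -/
import Mathlib

section
/- Let b ≥ 2 be an integer. The set T_b of Trott numbers in base b is nonempty if and only if b ∈ Γ, where Γ := {3} ∪ ⋃_{k=1}^∞ {k²+1, k²+2, …, k²+k}. -/
open Filter Topology

/-- Number of digits of `a` in base `b`. -/
def digLen (b a : ℕ) : ℕ := (Nat.digits b a).length

/-- Value of the finite continued fraction `[0; a₁, a₂, …, aₙ]`. -/
noncomputable def cfVal : List ℕ → ℝ
  | [] => 0
  | (h :: t) => 1 / ((h : ℝ) + cfVal t)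

/-- `a` witnesses that `x` is a Trott number in base `b`: the `a i` (indexed from 0)
are positive, `x` is the value of the infinite continued fraction `[0; a 0, a 1, …]`,
and the base-`b` expansion of `x` is the concatenation of the base-`b` digit strings
of the partial quotients. -/
def IsTrottWith (b : ℕ) (x : ℝ) (a : ℕ → ℕ) : Prop :=
  (∀ i, 0 < a i) ∧
  Tendsto (fun n => cfVal ((List.range n).map a)) atTop (𝓝 x) ∧
  x = ∑' i : ℕ, (a i : ℝ) / (b : ℝ) ^ (∑ j ∈ Finset.range (i + 1), digLen b (a j))

/-- `x` is a Trott number in base `b`. -/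
def IsTrott (b : ℕ) (x : ℝ) : Prop := ∃ a, IsTrottWith b x a

/-- The set of Trott numbers in base `b`. -/
def TrottSet (b : ℕ) : Set ℝ := {x | IsTrott b x}

/-- The set `Γ = {3} ∪ ⋃_{k≥1} {k²+1, …, k²+k}`. -/
def Gamma : Set ℕ := {b | b = 3 ∨ ∃ k : ℕ, 1 ≤ k ∧ k ^ 2 + 1 ≤ b ∧ b ≤ k ^ 2 + k}

/-- Pigeonhole principle: a property that holds infinitely often does so along a fibre of any
function with finite range. -/
theorem frequently_eq_of_mem_finite {p : ℕ → Prop} {f : ℕ → ℤ} {s : Set ℤ} (hs : s.Finite)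
    (hf : ∀ m, f m ∈ s) (hp : ∃ᶠ m in atTop, p m) : ∃ r ∈ s, ∃ᶠ m in atTop, p m ∧ f m = r := by
  by_contra! h
  refine hp ?_
  have h' := (eventually_all_finite hs).2 h
  filter_upwards [h'] with m hm hpm
  exact hm (f m) (hf m) hpm rfl

theorem eventually_mul_pow_add_lt {b : ℕ} (hb : 2 ≤ b) {u v : ℤ} (huv : u < v) (w z : ℤ) :
    ∀ᶠ m : ℕ in atTop, u * (b : ℤ) ^ m + w < v * (b : ℤ) ^ m + z := by
  filter_upwards [eventually_ge_atTop (w - z).natAbs] with m hm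
  have h1 : m < b ^ m := Nat.lt_pow_self (by omega)
  have h2 : (m : ℤ) < (b : ℤ) ^ m := by exact_mod_cast h1
  have h3 : w - z ≤ m := by omega
  nlinarith

/-- A number `α * b ^ m + β` with `β ≠ 0` has a factor prime to `b` that is unbounded in `m`. -/
theorem eventually_not_dvd_mul_pow {b : ℕ} (hb : 2 ≤ b) {α β C : ℤ} (hα : 0 < α) (hβ : β ≠ 0)
    (hC : 0 < C) : ∀ᶠ m : ℕ in atTop, ∀ k : ℕ, ¬ α * (b : ℤ) ^ m + β ∣ C * (b : ℤ) ^ k := by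
  filter_upwards [eventually_mul_pow_add_lt le_rfl zero_lt_one |β| 0,
    eventually_mul_pow_add_lt hb hα (C * |β|) β] with m h1 h2 k hk
  have h1' : |β| < (2 : ℤ) ^ m := by simpa using h1
  have hN : C * |β| < α * (b : ℤ) ^ m + β := by linarith
  have hβ' : 0 < |β| := abs_pos.2 hβ
  have key : α * (b : ℤ) ^ m + β ∣ C * (b : ℤ) ^ m := by
    rw [← Int.natAbs_dvd_natAbs, Nat.dvd_iff_prime_pow_dvd_dvd] at hk ⊢
    intro p e hp he
    have hke := hk p e hp he
    rw [Int.natAbs_mul, Int.natAbs_pow, Int.natAbs_natCast] at hke ⊢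
    by_cases hpb : p ∣ b
    · rcases le_or_gt e m with hem | hem
      · exact ((pow_dvd_pow p hem).trans (pow_dvd_pow_of_dvd hpb m)).mul_left _
      · have h5 : (p : ℤ) ^ m ∣ α * (b : ℤ) ^ m + β := by
          rw [← Int.natAbs_dvd_natAbs, Int.natAbs_pow, Int.natAbs_natCast]
          exact (pow_dvd_pow p hem.le).trans he
        have h6 : (p : ℤ) ^ m ∣ α * (b : ℤ) ^ m :=
          (pow_dvd_pow_of_dvd (Int.natCast_dvd_natCast.2 hpb) m).mul_left _
        have h7 : (p : ℤ) ^ m ≤ |β| :=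
          Int.le_of_dvd hβ' ((dvd_abs _ _).2 ((dvd_add_right h6).1 h5))
        have h8 : (2 : ℤ) ^ m ≤ (p : ℤ) ^ m :=
          pow_le_pow_left₀ (by norm_num) (by exact_mod_cast hp.two_le) m
        omega
    · exact (Nat.Coprime.dvd_of_dvd_mul_right
        (((hp.coprime_iff_not_dvd).2 hpb).pow e k) hke).mul_right _
  have h3 : α * (b : ℤ) ^ m + β ∣ C * β := by
    have : C * β = C * (α * (b : ℤ) ^ m + β) - α * (C * (b : ℤ) ^ m) := by ring
    rw [this]
    exact dvd_sub (Dvd.intro_left _ rfl) (key.mul_left _)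
  have h4 := Int.le_of_dvd (by positivity) ((dvd_abs _ _).2 h3)
  rw [abs_mul, abs_of_pos hC] at h4
  omega

/-- If `y` has no finite base-`b` expansion, then infinitely many shifts of it have a nonzero
leading digit and stay away from `1`. -/
theorem frequently_fract_mem {b : ℕ} (hb : 2 ≤ b) {y δ : ℝ}
    (hy : ∀ (k : ℕ) (z : ℤ), (b : ℝ) ^ k * y ≠ z) (hδb : b * δ < 1 - 1 / b) :
    ∃ᶠ m : ℕ in atTop, 1 / (b : ℝ) < Int.fract ((b : ℝ) ^ m * y) ∧
      Int.fract ((b : ℝ) ^ m * y) < 1 - δ := by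
  have hb' : (2 : ℝ) ≤ b := by exact_mod_cast hb
  have hb1 : (1 : ℝ) < b := by linarith
  have shift : ∀ (m j : ℕ) (c : ℤ) (t : ℝ), t = (b : ℝ) ^ j * Int.fract ((b : ℝ) ^ m * y) + c →
      0 ≤ t → t < 1 → Int.fract ((b : ℝ) ^ (m + j) * y) = t := by
    intro m j c t ht h0 h1
    refine Int.fract_eq_iff.2 ⟨h0, h1, (b : ℤ) ^ j * ⌊(b : ℝ) ^ m * y⌋ - c, ?_⟩
    have := Int.floor_add_fract ((b : ℝ) ^ m * y)
    rw [ht]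
    push_cast
    rw [pow_add]
    linear_combination -(b : ℝ) ^ j * this
  have fpos : ∀ m : ℕ, 0 < Int.fract ((b : ℝ) ^ m * y) := fun m =>
    (Int.fract_nonneg _).lt_of_ne fun h => hy m _ (sub_eq_zero.1 h.symm)
  rw [frequently_atTop]
  intro K
  obtain ⟨m, hm, hlo⟩ : ∃ m ≥ K, 1 / (b : ℝ) < Int.fract ((b : ℝ) ^ m * y) := by
    obtain ⟨j, hj1, hj2⟩ := exists_nat_pow_near (x := 1 / Int.fract ((b : ℝ) ^ K * y))
      (by rw [le_div_iff₀ (fpos K)]; linarith [Int.fract_lt_one ((b : ℝ) ^ K * y)]) hb1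
    rw [le_div_iff₀ (fpos K)] at hj1
    rw [div_lt_iff₀ (fpos K)] at hj2
    have hne : (b : ℝ) ^ j * Int.fract ((b : ℝ) ^ K * y) ≠ 1 := by
      intro h
      apply hy (j + K) (1 + (b : ℤ) ^ j * ⌊(b : ℝ) ^ K * y⌋)
      have := Int.floor_add_fract ((b : ℝ) ^ K * y)
      push_cast
      rw [pow_add]
      linear_combination h - (b : ℝ) ^ j * this
    refine ⟨K + j, by omega, ?_⟩
    rw [shift K j 0 ((b : ℝ) ^ j * Int.fract ((b : ℝ) ^ K * y)) (by simp)
      (mul_nonneg (by positivity) (fpos K).le) (lt_of_le_of_ne hj1 hne), div_lt_iff₀ (by linarith)]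
    rw [pow_succ] at hj2
    linarith
  by_cases hhi : Int.fract ((b : ℝ) ^ m * y) < 1 - δ
  · exact ⟨m, hm, hlo, hhi⟩
  push Not at hhi
  have hu : 0 < 1 - Int.fract ((b : ℝ) ^ m * y) := by linarith [Int.fract_lt_one ((b : ℝ) ^ m * y)]
  obtain ⟨j, hj1, hj2⟩ := exists_nat_pow_near (x := δ / (1 - Int.fract ((b : ℝ) ^ m * y)))
      (by rw [le_div_iff₀ hu]; linarith) hb1
  rw [le_div_iff₀ hu] at hj1
  rw [div_lt_iff₀ hu] at hj2
  have h3 : (b : ℝ) ^ (j + 1) * (1 - Int.fract ((b : ℝ) ^ m * y)) ≤ b * δ := by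
    rw [pow_succ]; nlinarith
  have h5 : 0 < 1 / (b : ℝ) := by positivity
  refine ⟨m + (j + 1), by omega, ?_⟩
  rw [shift m (j + 1) (1 - (b : ℤ) ^ (j + 1))
    (1 - (b : ℝ) ^ (j + 1) * (1 - Int.fract ((b : ℝ) ^ m * y))) (by push_cast; ring)
    (by linarith) (by linarith)]
  constructor <;> linarith

theorem digLen_eq_of_pow_le_of_lt {b a m : ℕ} (hb : 2 ≤ b) (hm : 1 ≤ m)
    (h1 : b ^ (m - 1) ≤ a) (h2 : a < b ^ m) :
    digLen b a = m := by
  unfold digLen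
  have := (Nat.digits_length_le_iff (by omega : 1 < b) (k := m) a).2 h2
  have := (Nat.lt_digits_length_iff (by omega : 1 < b) (k := m - 1) a).2 h1
  omega

/-- Data of a finite list of partial quotients: the last two convergents `p / q` and `pPrev / qPrev`,
the concatenation `W` of the digit strings, and the total number `s` of digits. -/
structure CFState where
  p : ℤ
  q : ℤ
  pPrev : ℤ
  qPrev : ℤ
  W : ℤ
  s : ℕ

namespace CFState

/-- Append the partial quotient `a`. -/
def step (b : ℕ) (S : CFState) (a : ℕ) : CFState where
  p := a * S.p + S.pPrev
  q := a * S.q + S.qPrev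
  pPrev := S.p
  qPrev := S.q
  W := S.W * (b : ℤ) ^ digLen b a + a
  s := S.s + digLen b a

/-- The position of `p / q` in the interval of numbers whose expansion starts with the digits
of `W` is `excess / q`. -/
def excess (b : ℕ) (S : CFState) : ℤ := (b : ℤ) ^ S.s * S.p - S.W * S.q

/-- The numerator of the position of `pPrev / qPrev` in the interval belonging to `W`. -/
def prevExcess (b : ℕ) (S : CFState) : ℤ := (b : ℤ) ^ S.s * S.pPrev - S.W * S.qPrev

/-- The convergent `p / q` lies in the interval belonging to `W`. -/
def Fits (b : ℕ) (S : CFState) : Prop := 0 < S.q ∧ 0 ≤ S.excess b ∧ S.excess b ≤ S.q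

/-- States from which the construction can be continued by two further partial quotients. -/
structure Extendable (b : ℕ) (S : CFState) : Prop where
  q_pos : 0 < S.q
  det : S.p * S.qPrev - S.pPrev * S.q = -1
  lo : S.q < b * S.excess b
  hi : S.excess b < S.q
  q_not_dvd : ∀ k : ℕ, ¬ S.q ∣ (b : ℤ) ^ k
  excess_not_dvd : ∀ k : ℕ, ¬ S.excess b ∣ (b : ℤ) ^ k
  small : (b : ℤ) ^ 2 * (b : ℤ) ^ S.s < S.q * S.excess b

theorem excess_step (b : ℕ) (S : CFState) (a : ℕ) : (S.step b a).excess b =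
    a * ((b : ℤ) ^ digLen b a * S.excess b - a * S.q) +
      (b : ℤ) ^ digLen b a * S.prevExcess b - a * S.qPrev := by
  simp only [excess, prevExcess, step, pow_add]; ring

theorem prevExcess_step (b : ℕ) (S : CFState) (a : ℕ) : (S.step b a).prevExcess b =
    (b : ℤ) ^ digLen b a * S.excess b - a * S.q := by
  simp only [excess, prevExcess, step, pow_add]; ring

theorem Extendable.fits {b : ℕ} {S : CFState} (h : S.Extendable b) : S.Fits b :=
  ⟨h.q_pos, by have := h.lo; have := h.q_pos; by_contra! hc; nlinarith, h.hi.le⟩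

end CFState

theorem exists_floor_mul_pow {b m : ℕ} (hb : 2 ≤ b) (hm : 1 ≤ m) {G H : ℤ} (hH : 0 < H)
    (hlo : H < b * G) (hhi : G < H) :
    ∃ a : ℕ, digLen b a = m ∧ 0 < a ∧ (b : ℤ) ^ (m - 1) ≤ a ∧
      (b : ℤ) ^ m * G = a * H + (b : ℤ) ^ m * G % H := by
  have h1 : (b : ℤ) ^ (m - 1) ≤ (b : ℤ) ^ m * G / H := by
    rw [Int.le_ediv_iff_mul_le hH]
    obtain ⟨n, rfl⟩ : ∃ n, m = n + 1 := ⟨m - 1, by omega⟩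
    have : (0 : ℤ) < (b : ℤ) ^ n := by positivity
    simp only [Nat.add_sub_cancel, pow_succ]
    nlinarith
  have h2 : (b : ℤ) ^ m * G / H < (b : ℤ) ^ m := by
    rw [Int.ediv_lt_iff_lt_mul hH]
    have : (0 : ℤ) < (b : ℤ) ^ m := by positivity
    nlinarith
  have h0 : (0 : ℤ) < (b : ℤ) ^ (m - 1) := by positivity
  obtain ⟨a, ha⟩ := Int.eq_ofNat_of_zero_le (h0.le.trans h1)
  rw [ha] at h1 h2
  refine ⟨a, digLen_eq_of_pow_le_of_lt hb hm (by exact_mod_cast h1) (by exact_mod_cast h2),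
    by exact_mod_cast h0.trans_le h1, h1, ?_⟩
  have := Int.mul_ediv_add_emod ((b : ℤ) ^ m * G) H
  rw [ha] at this
  linarith

theorem frequently_emod_mem {b : ℕ} (hb : 2 ≤ b) {G H d : ℤ} (hH : 0 < H)
    (hG : ∀ k : ℕ, ¬ H ∣ (b : ℤ) ^ k * G) {P : ℤ} (hP : 0 < P)
    (hd : (b : ℤ) ^ 2 * d < (b - 1) * (H * P)) :
    ∃ᶠ m : ℕ in atTop, H < b * ((b : ℤ) ^ m * G % H) ∧ ((b : ℤ) ^ m * G % H) * P + d < H * P := by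
  have hb' : (2 : ℝ) ≤ b := by exact_mod_cast hb
  have hH' : (0 : ℝ) < H := by exact_mod_cast hH
  have hP' : (0 : ℝ) < P := by exact_mod_cast hP
  have hd' : (b : ℝ) ^ 2 * d < (b - 1) * (H * P) := by exact_mod_cast hd
  have hf : ∀ m : ℕ, Int.fract ((b : ℝ) ^ m * ((G : ℝ) / H)) = (((b : ℤ) ^ m * G % H : ℤ) : ℝ) / H := by
    intro m
    refine Int.fract_eq_iff.2 ⟨?_, ?_, (b : ℤ) ^ m * G / H, ?_⟩
    · have : (0 : ℝ) ≤ (((b : ℤ) ^ m * G % H : ℤ) : ℝ) := by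
        exact_mod_cast Int.emod_nonneg _ hH.ne'
      positivity
    · rw [div_lt_one hH']
      exact_mod_cast Int.emod_lt_of_pos _ hH
    · have h := Int.mul_ediv_add_emod ((b : ℤ) ^ m * G) H
      have h' : (H : ℝ) * (((b : ℤ) ^ m * G / H : ℤ) : ℝ) + (((b : ℤ) ^ m * G % H : ℤ) : ℝ)
          = (b : ℝ) ^ m * G := by exact_mod_cast h
      field_simp
      linear_combination -h'
  refine (frequently_fract_mem hb (y := (G : ℝ) / H) (δ := (d : ℝ) / (H * P)) ?_ ?_).mono ?_
  · intro k z hz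
    apply hG k
    refine ⟨z, ?_⟩
    field_simp at hz
    have : (b : ℝ) ^ k * G = H * z := by linarith
    exact_mod_cast this
  · rw [one_sub_div (by positivity), mul_div_assoc', div_lt_div_iff₀ (by positivity) (by positivity)]
    linarith
  · rintro m ⟨h1, h2⟩
    rw [hf] at h1 h2
    rw [div_lt_div_iff₀ (by positivity) hH'] at h1
    rw [div_lt_iff₀ hH', sub_mul, div_mul_eq_mul_div, lt_sub_iff_add_lt, one_mul] at h2
    constructor
    · have : (H : ℝ) < b * (((b : ℤ) ^ m * G % H : ℤ) : ℝ) := by linarith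
      exact_mod_cast this
    · have : (((b : ℤ) ^ m * G % H : ℤ) : ℝ) * P + d < H * P := by
        have h3 := mul_lt_mul_of_pos_right h2 hP'
        have h4 : (d : ℝ) * H / (H * P) * P = d := by field_simp
        rw [add_mul, h4] at h3
        exact h3
      exact_mod_cast this

namespace CFState

set_option maxHeartbeats 1000000 in
theorem Extendable.exists_step {b : ℕ} (hb : 2 ≤ b) {S : CFState} (h : S.Extendable b) :
    ∃ a A : ℕ, 0 < a ∧ 0 < A ∧ (S.step b a).Fits b ∧ ((S.step b a).step b A).Extendable b := by
  have hq := h.q_pos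
  have hP : 0 < S.excess b := by have := h.lo; by_contra! hc; nlinarith
  have hdet : S.excess b * S.qPrev - S.prevExcess b * S.q = -(b : ℤ) ^ S.s := by
    simp only [excess, prevExcess]; linear_combination (b : ℤ) ^ S.s * h.det
  have hbz : (2 : ℤ) ≤ b := by exact_mod_cast hb
  have hD : (0 : ℤ) < (b : ℤ) ^ S.s := by positivity
  have hnd : ∀ k : ℕ, ¬ S.q ∣ (b : ℤ) ^ k * S.excess b := by
    intro k hk
    apply h.q_not_dvd (k + S.s)
    have : (b : ℤ) ^ (k + S.s) = S.q * ((b : ℤ) ^ k * S.prevExcess b) -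
        (b : ℤ) ^ k * S.excess b * S.qPrev := by
      rw [pow_add]; linear_combination (b : ℤ) ^ k * hdet
    rw [this]
    exact dvd_sub (Dvd.intro _ rfl) (hk.mul_right _)
  obtain ⟨ρ, -, hρ⟩ := frequently_eq_of_mem_finite (f := fun m => (b : ℤ) ^ m * S.excess b % S.q)
    (Set.finite_Ico 0 S.q) (fun m => ⟨Int.emod_nonneg _ hq.ne', Int.emod_lt_of_pos _ hq⟩)
    (frequently_emod_mem hb hq hnd hP (d := (b : ℤ) ^ S.s) (by have := h.small; nlinarith [mul_pos hq hP]))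
  have hndP := h.excess_not_dvd
  have hlo := h.lo
  have hhi := h.hi
  generalize hPdef : S.excess b = P at *
  generalize hQdef : S.prevExcess b = Q at *
  generalize hqdef : S.q = q at *
  generalize hqdef' : S.qPrev = q' at *
  generalize hDdef : (b : ℤ) ^ S.s = D at *
  obtain ⟨m₀, ⟨hρlo, hρhi⟩, hm₀⟩ := hρ.exists
  simp only [hm₀] at hρlo hρhi
  set G := ρ * P + D with hG
  set H := q * P with hH
  have hHpos : 0 < H := mul_pos hq hP
  have hGlo : H < b * G := by simp only [hH, hG]; nlinarith
  have hndG : ∀ k : ℕ, ¬ H ∣ (b : ℤ) ^ k * G := by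
    intro k hk
    apply hndP (k + S.s)
    have h1 : P ∣ (b : ℤ) ^ k * G := (Dvd.intro_left _ rfl).trans hk
    have h2 : (b : ℤ) ^ (k + S.s) = (b : ℤ) ^ k * G - P * ((b : ℤ) ^ k * ρ) := by
      rw [pow_add, hDdef]; ring
    rw [h2]
    exact dvd_sub h1 (Dvd.intro _ rfl)
  obtain ⟨m', ⟨hσlo, hσhi⟩, hm'⟩ := ((frequently_emod_mem hb hHpos hndG (P := 1) zero_lt_one (d := 0)
    (by nlinarith)).and_eventually (eventually_ge_atTop (q.toNat + 1))).exists
  obtain ⟨A, hAlen, hApos, hAge, hA⟩ := exists_floor_mul_pow hb (m := m') (by omega) hHpos hGlo hρhi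
  generalize (b : ℤ) ^ m' * G % H = σ at hσlo hσhi hA
  have hAq : q < A := by
    have h1 : m' - 1 < b ^ (m' - 1) := Nat.lt_pow_self (by omega)
    have h2 : ((m' - 1 : ℕ) : ℤ) < (b : ℤ) ^ (m' - 1) := by exact_mod_cast h1
    omega
  have hAz : (0 : ℤ) < A := by exact_mod_cast hApos
  have hσ : 0 < σ := by by_contra! hc; nlinarith
  set Y := (b : ℤ) ^ m' with hY
  have hβ : A * (q' - ρ) + q ≠ 0 := by
    intro h0
    have : (A : ℤ) ∣ q := ⟨ρ - q', by linarith⟩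
    have := Int.le_of_dvd hq this
    omega
  set β := A * (q' - ρ) + q with hβdef
  have hτ : Y * ρ - A * q ≠ 0 := by
    intro h0
    apply hnd (m' + m₀)
    have h1 := Int.mul_ediv_add_emod ((b : ℤ) ^ m₀ * P) q
    refine ⟨A + Y * ((b : ℤ) ^ m₀ * P / q), ?_⟩
    rw [hm₀] at h1
    rw [pow_add, ← hY]
    linear_combination h0 - Y * h1
  set τ := Y * ρ - A * q with hτdef
  have hAP : 0 < A * P := mul_pos hAz hP
  have hAσ : 0 < A * σ := mul_pos hAz hσ
  obtain ⟨m, ⟨-, hm⟩, ⟨⟨⟨h1, h2, h3⟩, ⟨h4, h5, h6⟩⟩, ⟨h7, h8, h9⟩, hm1⟩⟩ := (hρ.and_eventually (((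
    (eventually_mul_pow_add_lt hb hGlo (q * (q' - ρ)) (b * (ρ * (q' - ρ)))).and
    ((eventually_mul_pow_add_lt hb hρhi (ρ * (q' - ρ)) (q * (q' - ρ))).and
    (eventually_mul_pow_add_lt hb hP 0 (q' - ρ)))).and
    ((eventually_mul_pow_add_lt hb (u := q * (A * P)) (v := b * (A * σ)) (by nlinarith)
      (q * β) (b * (τ * β))).and
    ((eventually_mul_pow_add_lt hb (u := A * σ) (v := q * (A * P)) (by nlinarith)
      (τ * β) (q * β)).and
    (eventually_mul_pow_add_lt hb (u := 0) (v := A * σ) hAσ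
      (2 * (b ^ 2 * (D * Y * q))) (τ * β))))).and
    ((eventually_mul_pow_add_lt hb (u := 1) (v := 2 * (A * P)) (by linarith) 0 (2 * β)).and
    ((eventually_not_dvd_mul_pow hb hAP hβ zero_lt_one).and
    (eventually_not_dvd_mul_pow hb hAσ (mul_ne_zero hτ hβ) hq)) |>.and
    (eventually_ge_atTop 1)))).exists
  obtain ⟨a, halen, hapos, -, ha⟩ := exists_floor_mul_pow hb hm1 hq hlo hhi
  simp only [hm] at ha
  set X := (b : ℤ) ^ m with hX
  have hXpos : 0 < X := by positivity
  have hq1 : (S.step b a).q = P * X + (q' - ρ) := by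
    simp only [step, hqdef, hqdef']; linear_combination -ha
  have hQ1 : (S.step b a).prevExcess b = ρ := by
    rw [prevExcess_step, halen, hPdef, hqdef]; linear_combination ha
  have hP1 : q * (S.step b a).excess b = G * X + ρ * (q' - ρ) := by
    rw [excess_step, halen, hPdef, hQdef, hqdef, hqdef']
    linear_combination (q' + (a : ℤ) * q - ρ) * ha - X * hdet
  have hq1' : (S.step b a).qPrev = q := hqdef
  have hs1 : (b : ℤ) ^ (S.step b a).s = D * X := by simp only [step, halen, pow_add, hDdef, hX]
  have hdet1 : (S.step b a).p * (S.step b a).qPrev - (S.step b a).pPrev * (S.step b a).q = 1 := by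
    have := h.det
    rw [hqdef, hqdef'] at this
    simp only [step, hqdef, hqdef']
    linear_combination -this
  refine ⟨a, A, hapos, hApos, ⟨by rw [hq1]; linarith, ?_, ?_⟩, ?_⟩
  · have h10 : q * (S.step b a).q < q * (b * (S.step b a).excess b) := by
      rw [hq1, mul_left_comm, hP1]; linarith
    have h11 := lt_of_mul_lt_mul_left h10 hq.le
    have h12 : 0 < b * (S.step b a).excess b := by linarith
    exact (pos_of_mul_pos_right h12 (by linarith)).le
  · refine le_of_mul_le_mul_left ?_ hq
    rw [hq1, hP1]
    linarith
  generalize S.step b a = T at *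
  have hq2 : (T.step b A).q = A * P * X + β := by
    simp only [step, hq1, hq1', hβdef]; ring
  have hP2 : q * (T.step b A).excess b = A * σ * X + τ * β := by
    rw [excess_step, hAlen, hQ1, hq1, hq1', ← hY, hβdef, hτdef]
    linear_combination (A : ℤ) * Y * hP1 + (A : ℤ) * X * hA + (A : ℤ) ^ 2 * X * hH
  have hs2 : (b : ℤ) ^ (T.step b A).s = D * X * Y := by
    simp only [step, pow_add, hs1, hAlen, hY]
  have hdet2 : (T.step b A).p * (T.step b A).qPrev - (T.step b A).pPrev * (T.step b A).q = -1 := by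
    simp only [step]; linear_combination -hdet1
  generalize T.step b A = U at *
  have hU : 0 < U.q := by rw [hq2]; linarith
  refine ⟨hU, hdet2, ?_, ?_, ?_, ?_, ?_⟩
  · refine lt_of_mul_lt_mul_left ?_ hq.le
    rw [hq2, mul_left_comm, hP2]
    linarith
  · refine lt_of_mul_lt_mul_left ?_ hq.le
    rw [hq2, hP2]
    linarith
  · intro k hk
    rw [hq2] at hk
    exact h8 k (by rwa [one_mul])
  · intro k hk
    apply h9 k
    rw [← hP2]
    exact mul_dvd_mul_left q hk
  · refine lt_of_mul_lt_mul_left ?_ hq.le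
    rw [hs2, mul_left_comm q U.q, hP2]
    have hK : 0 < (b : ℤ) ^ 2 * (D * Y * q) := by positivity
    have h10 : X < 2 * U.q := by rw [hq2]; linarith
    have h11 : 2 * ((b : ℤ) ^ 2 * (D * Y * q)) < A * σ * X + τ * β := by linarith
    calc q * ((b : ℤ) ^ 2 * (D * X * Y)) = (b : ℤ) ^ 2 * (D * Y * q) * X := by ring
      _ < (b : ℤ) ^ 2 * (D * Y * q) * (2 * U.q) := mul_lt_mul_of_pos_left h10 hK
      _ = U.q * (2 * ((b : ℤ) ^ 2 * (D * Y * q))) := by ring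
      _ < U.q * (A * σ * X + τ * β) := mul_lt_mul_of_pos_left h11 hU

/-- The state of a list of partial quotients. -/
def run (b : ℕ) (l : List ℕ) : CFState := l.foldl (step b) ⟨0, 1, 1, 0, 0, 0⟩

theorem run_append_singleton (b : ℕ) (l : List ℕ) (a : ℕ) :
    run b (l ++ [a]) = (run b l).step b a := by simp [run]

theorem run_q_pos (b : ℕ) (l : List ℕ) (hl : ∀ a ∈ l, 0 < a) :
    0 < (run b l).q ∧ 0 ≤ (run b l).qPrev := by
  induction l using List.reverseRecOn with
  | nil => simp [run]
  | append_singleton l a ih =>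
    obtain ⟨h1, h2⟩ := ih fun c hc => hl c (by simp [hc])
    have ha : (0 : ℤ) < a := by exact_mod_cast hl a (by simp)
    rw [run_append_singleton]
    exact ⟨by simp only [step]; positivity, h1.le⟩

theorem cfVal_eq_foldr (l : List ℕ) :
    cfVal l = l.foldr (fun (a : ℕ) (y : ℝ) => 1 / ((a : ℝ) + y)) 0 := by
  induction l with
  | nil => rfl
  | cons a l ih => simp only [cfVal, List.foldr, ih]

theorem foldr_eq_div (b : ℕ) (l : List ℕ) (hl : ∀ a ∈ l, 0 < a) {t : ℝ} (ht : 0 ≤ t) :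
    l.foldr (fun (a : ℕ) (y : ℝ) => 1 / ((a : ℝ) + y)) t =
      ((run b l).p + t * (run b l).pPrev) / ((run b l).q + t * (run b l).qPrev) := by
  induction l using List.reverseRecOn generalizing t with
  | nil => simp [run]
  | append_singleton l a ih =>
    have hl' : ∀ c ∈ l, 0 < c := fun c hc => hl c (by simp [hc])
    have ha : (0 : ℝ) < a := by exact_mod_cast hl a (by simp)
    obtain ⟨h1, h2⟩ := run_q_pos b l hl'
    have h1' : (0 : ℝ) < (run b l).q := by exact_mod_cast h1
    have h2' : (0 : ℝ) ≤ (run b l).qPrev := by exact_mod_cast h2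
    rw [List.foldr_append, List.foldr_cons, List.foldr_nil, ih hl' (by positivity),
      run_append_singleton]
    simp only [step]
    push_cast
    rw [div_eq_div_iff (by positivity) (by positivity)]
    field_simp
    ring

theorem cfVal_eq_div (b : ℕ) (l : List ℕ) (hl : ∀ a ∈ l, 0 < a) :
    cfVal l = (run b l).p / (run b l).q := by
  simpa using (cfVal_eq_foldr l).trans (foldr_eq_div b l hl le_rfl)

theorem run_range_s (b : ℕ) (a : ℕ → ℕ) (n : ℕ) :
    (run b ((List.range n).map a)).s = ∑ j ∈ Finset.range n, digLen b (a j) := by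
  induction n with
  | zero => simp [run]
  | succ n ih =>
    rw [List.range_succ, List.map_append, List.map_singleton, run_append_singleton,
      Finset.sum_range_succ]
    simp only [step, ih]

theorem sum_eq_run_W_div {b : ℕ} (hb : 2 ≤ b) (a : ℕ → ℕ) (n : ℕ) :
    ∑ i ∈ Finset.range n, (a i : ℝ) / (b : ℝ) ^ (∑ j ∈ Finset.range (i + 1), digLen b (a j)) =
      (run b ((List.range n).map a)).W / (b : ℝ) ^ (run b ((List.range n).map a)).s := by
  induction n with
  | zero => simp [run]
  | succ n ih =>
    have hb' : (0 : ℝ) < b := by exact_mod_cast (by omega : 0 < b)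
    rw [Finset.sum_range_succ, ih, Finset.sum_range_succ, ← run_range_s, List.range_succ,
      List.map_append, List.map_singleton, run_append_singleton]
    simp only [step]
    push_cast
    rw [pow_add]
    field_simp

theorem run_W_lt {b : ℕ} (hb : 2 ≤ b) (l : List ℕ) : (run b l).W < (b : ℤ) ^ (run b l).s := by
  induction l using List.reverseRecOn with
  | nil => simp [run]
  | append_singleton l a ih =>
    rw [run_append_singleton]
    simp only [step, pow_add]
    have h1 : a < b ^ digLen b a := Nat.lt_base_pow_length_digits (by omega)
    have h2 : (a : ℤ) < (b : ℤ) ^ digLen b a := by exact_mod_cast h1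
    nlinarith

end CFState

theorem digLen_pos {b a : ℕ} (ha : 0 < a) : 0 < digLen b a := by
  unfold digLen
  exact List.length_pos_iff.2 (Nat.digits_ne_nil_iff_ne_zero.2 ha.ne')

open CFState in
theorem sum_concat_digits_le_one {b : ℕ} (hb : 2 ≤ b) (a : ℕ → ℕ) (n : ℕ) :
    ∑ i ∈ Finset.range n, (a i : ℝ) / (b : ℝ) ^ (∑ j ∈ Finset.range (i + 1), digLen b (a j)) ≤ 1 := by
  have hb' : (0 : ℝ) < b := by exact_mod_cast (by omega : 0 < b)
  rw [sum_eq_run_W_div hb, div_le_one (by positivity)]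
  exact_mod_cast (run_W_lt hb _).le

theorem summable_concat_digits {b : ℕ} (hb : 2 ≤ b) (a : ℕ → ℕ) :
    Summable fun i => (a i : ℝ) / (b : ℝ) ^ (∑ j ∈ Finset.range (i + 1), digLen b (a j)) :=
  summable_of_sum_range_le (fun _ => by positivity) (sum_concat_digits_le_one hb a)

namespace CFState

theorem isTrott_of_fits {b : ℕ} (hb : 2 ≤ b) {a : ℕ → ℕ} (ha : ∀ i, 0 < a i)
    (hfit : ∀ᶠ n in atTop, (run b ((List.range n).map a)).Fits b) :
    IsTrott b (∑' i : ℕ, (a i : ℝ) / (b : ℝ) ^ (∑ j ∈ Finset.range (i + 1), digLen b (a j))) := by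
  have hb' : (1 : ℝ) < b := by exact_mod_cast (by omega : 1 < b)
  refine ⟨a, ha, ?_, rfl⟩
  have h1 := (summable_concat_digits hb a).hasSum.tendsto_sum_nat
  have h2 : Tendsto (fun n : ℕ => (1 / (b : ℝ)) ^ n) atTop (𝓝 0) :=
    tendsto_pow_atTop_nhds_zero_of_lt_one (by positivity) (by rw [div_lt_one] <;> linarith)
  have h3 := h1.add h2
  rw [add_zero] at h3
  refine tendsto_of_tendsto_of_tendsto_of_le_of_le' h1 h3 ?_ ?_
  all_goals
    filter_upwards [hfit] with n hn
    rw [sum_eq_run_W_div hb, cfVal_eq_div b _ (by simp [ha])]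
    have hs : n ≤ (run b ((List.range n).map a)).s := by
      rw [run_range_s]
      calc n = ∑ _j ∈ Finset.range n, 1 := by simp
        _ ≤ _ := Finset.sum_le_sum fun i _ => digLen_pos (ha i)
    obtain ⟨hq, he, hq'⟩ := hn
    unfold excess at he hq'
    generalize run b ((List.range n).map a) = S at *
    have hqr : (0 : ℝ) < S.q := by exact_mod_cast hq
    have her : (0 : ℝ) ≤ (b : ℝ) ^ S.s * S.p - S.W * S.q := by exact_mod_cast he
    have hqr' : (b : ℝ) ^ S.s * S.p - S.W * S.q ≤ S.q := by exact_mod_cast hq'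
  · rw [div_le_div_iff₀ (by positivity) hqr]
    linarith
  · have h4 : (1 / (b : ℝ)) ^ S.s ≤ (1 / (b : ℝ)) ^ n :=
      pow_le_pow_of_le_one (by positivity) (by rw [div_le_one] <;> linarith) hs
    refine le_trans ?_ (add_le_add_right h4 _)
    rw [one_div_pow, ← add_div, div_le_div_iff₀ hqr (by positivity)]
    linarith

theorem exists_seq_of_forall_exists_append {G : List ℕ → Prop} (hG : ∀ l, G l → ∃ a, G (l ++ [a]))
    {l₀ : List ℕ} (h₀ : G l₀) : ∃ a : ℕ → ℕ, ∀ n ≥ l₀.length, G ((List.range n).map a) := by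
  choose f hf using hG
  let L : ℕ → {l // G l} := fun n =>
    Nat.rec ⟨l₀, h₀⟩ (fun _ l => ⟨l.1 ++ [f l.1 l.2], hf l.1 l.2⟩) n
  have hlen : ∀ n, (L n).1.length = l₀.length + n := by
    intro n
    induction n with
    | zero => rfl
    | succ n ih =>
      change ((L n).1 ++ [f (L n).1 (L n).2]).length = _
      simp [ih]; omega
  have hpre : ∀ i j, (L i).1 <+: (L (i + j)).1 := by
    intro i j
    induction j with
    | zero => exact List.prefix_refl _
    | succ j ih => exact ih.trans (List.prefix_append _ _)
  refine ⟨fun n => (L (n + 1)).1.getD n 0, fun n hn => ?_⟩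
  obtain ⟨i, rfl⟩ := Nat.exists_eq_add_of_le hn
  convert (L i).2
  refine List.ext_getElem (by simp [hlen]) fun k h1 h2 => ?_
  have hk : k < (L (k + 1)).1.length := by have := hlen (k + 1); omega
  simp only [List.getElem_map, List.getElem_range]
  rw [List.getD_eq_getElem _ _ hk]
  rcases le_total i (k + 1) with h | h
  · obtain ⟨j, hj⟩ := Nat.exists_eq_add_of_le h
    exact (((hj ▸ hpre i j : (L i).1 <+: (L (k + 1)).1)).getElem h2).symm
  · obtain ⟨j, rfl⟩ := Nat.exists_eq_add_of_le h
    exact (hpre (k + 1) j).getElem hk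

theorem trottSet_nonempty_of_extendable {b : ℕ} (hb : 2 ≤ b) {l : List ℕ} (hl : ∀ a ∈ l, 0 < a)
    (h : (run b l).Extendable b) : (TrottSet b).Nonempty := by
  have hG : ∀ l, ((∀ a ∈ l, 0 < a) ∧ (run b l).Fits b ∧
      ((run b l).Extendable b ∨ ∃ A, 0 < A ∧ ((run b l).step b A).Extendable b)) →
      ∃ c, (∀ a ∈ l ++ [c], 0 < a) ∧ (run b (l ++ [c])).Fits b ∧ ((run b (l ++ [c])).Extendable b ∨
        ∃ A, 0 < A ∧ ((run b (l ++ [c])).step b A).Extendable b) := by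
    rintro l ⟨hl, -, hE | ⟨A, hA, hE⟩⟩
    · obtain ⟨a, A, ha, hA, hfit, hext⟩ := hE.exists_step hb
      refine ⟨a, ?_, ?_⟩
      · simpa [or_imp, forall_and] using ⟨hl, ha⟩
      · rw [run_append_singleton]
        exact ⟨hfit, Or.inr ⟨A, hA, hext⟩⟩
    · refine ⟨A, ?_, ?_⟩
      · simpa [or_imp, forall_and] using ⟨hl, hA⟩
      · rw [run_append_singleton]
        exact ⟨hE.fits, Or.inl hE⟩
  obtain ⟨a, ha⟩ := exists_seq_of_forall_exists_append hG ⟨hl, h.fits, Or.inl h⟩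
  refine ⟨_, isTrott_of_fits hb (a := a) (fun i => ?_) ?_⟩
  · exact (ha (l.length + i + 1) (by omega)).1 (a i) (by simp; exact ⟨i, by omega, rfl⟩)
  · filter_upwards [eventually_ge_atTop l.length] with n hn
    exact (ha n hn).2.1

/-- A starting point in base `3`. -/
theorem extendable_base_three : (run 3 [1, 1, 125, 2]).Extendable 3 := by
  have hrun : run 3 [1, 1, 125, 2] = ⟨253, 504, 126, 251, 3293, 8⟩ := by
    simp [run, step, digLen]
  have hex : excess 3 ⟨253, 504, 126, 251, 3293, 8⟩ = 261 := by norm_num [excess]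
  rw [hrun]
  refine ⟨by norm_num, by norm_num, ?_, ?_, ?_, ?_, ?_⟩ <;> try rw [hex]
  · norm_num
  · norm_num
  · intro k hk
    have h2 : (2 : ℤ) ∣ ((3 : ℕ) : ℤ) ^ k := dvd_trans (by norm_num) hk
    have := Int.prime_two.dvd_of_dvd_pow h2
    norm_num at this
  · intro k hk
    have h2 : (29 : ℤ) ∣ ((3 : ℕ) : ℤ) ^ k := dvd_trans (by norm_num) hk
    have hp : Prime (29 : ℤ) := by norm_num
    have := hp.dvd_of_dvd_pow h2
    norm_num at this
  · norm_num

/-- For `b = k ^ 2 + j` with `1 ≤ j ≤ k` one can start with `[k, c]` where `c` is close to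
`j / k * b ^ m` for a large `m`. -/
theorem exists_extendable_of_sq_lt {b k : ℕ} (hk : 1 ≤ k) (h1 : k ^ 2 + 1 ≤ b) (h2 : b ≤ k ^ 2 + k) :
    ∃ l : List ℕ, (∀ a ∈ l, 0 < a) ∧ (run b l).Extendable b := by
  have hb : 2 ≤ b := by nlinarith
  have hkb : k < b := by nlinarith
  obtain ⟨j, rfl⟩ : ∃ j, b = k ^ 2 + j := ⟨b - k ^ 2, by omega⟩
  have hkz : (1 : ℤ) ≤ k := by exact_mod_cast hk
  have hjz : (1 : ℤ) ≤ j := by exact_mod_cast (by omega : 1 ≤ j)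
  have hjk : (j : ℤ) ≤ k := by exact_mod_cast (by omega : j ≤ k)
  have hbz : ((k ^ 2 + j : ℕ) : ℤ) = (k : ℤ) ^ 2 + j := by push_cast; ring
  generalize hbdef : k ^ 2 + j = b at *
  obtain ⟨r₀, -, hr₀⟩ := frequently_eq_of_mem_finite (p := fun _ => True)
    (f := fun m => (j : ℤ) * (b : ℤ) ^ m % k) (Set.finite_Ico 0 (k : ℤ))
    (fun m => ⟨Int.emod_nonneg _ (by omega), Int.emod_lt_of_pos _ (by omega)⟩)
    (Frequently.of_forall fun _ => trivial)
  obtain ⟨r, hrk, hrlo, hrhi⟩ : ∃ r : ℤ, (k : ℤ) ∣ r₀ - r ∧ (k : ℤ) ^ 2 < (r - 1) * j ∧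
      (r - 1) * j ≤ (k : ℤ) ^ 2 + k * j := by
    have hu1 := Int.mul_ediv_add_emod ((k : ℤ) ^ 2) j
    have hu2 := Int.emod_nonneg ((k : ℤ) ^ 2) (by omega : (j : ℤ) ≠ 0)
    have hu3 := Int.emod_lt_of_pos ((k : ℤ) ^ 2) (by omega : (0 : ℤ) < j)
    generalize (k : ℤ) ^ 2 / j = u at *
    generalize (k : ℤ) ^ 2 % j = v at *
    have ht1 := Int.mul_ediv_add_emod (r₀ - (u + 2)) k
    have ht2 := Int.emod_nonneg (r₀ - (u + 2)) (by omega : (k : ℤ) ≠ 0)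
    have ht3 := Int.emod_lt_of_pos (r₀ - (u + 2)) (by omega : (0 : ℤ) < k)
    generalize (r₀ - (u + 2)) % k = t at *
    refine ⟨u + 2 + t, ⟨(r₀ - (u + 2)) / k, by linarith⟩, by nlinarith, ?_⟩
    have : (u + 2 + t - 1) * j ≤ (u + k) * j := mul_le_mul_of_nonneg_right (by omega) (by omega)
    nlinarith
  have hr : (k : ℤ) < r - 1 := by
    by_contra! hc
    nlinarith
  obtain ⟨e, he⟩ : ∃ e, e = (r - 1) * j - (k : ℤ) ^ 2 := ⟨_, rfl⟩
  have he1 : 1 ≤ e := by omega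
  have he2 : e ≤ k * j := by linarith
  have hkj : (k : ℤ) * j < b := by rw [hbz]; nlinarith
  have hkjb : (k : ℤ) < b * j := by nlinarith
  obtain ⟨m, ⟨-, hm⟩, ⟨⟨g1, g2, g3⟩, g4, g5, hm1⟩, g6⟩ := (hr₀.and_eventually ((
    (eventually_mul_pow_add_lt hb hkjb (b * r) 0).and
    ((eventually_mul_pow_add_lt hb (u := k * j) (v := b * e) (by nlinarith)
      (-(k * (r - 1))) (-(b * (r * (r - 1))))).and
    (eventually_mul_pow_add_lt hb (u := 1) (v := 2 * j) (by linarith) 0 (-(2 * (r - 1)))))).and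
    ((eventually_not_dvd_mul_pow hb (α := j) (β := -(r - 1)) (by linarith) (by omega)
      zero_lt_one).and
    ((eventually_not_dvd_mul_pow hb (α := e) (β := -(r * (r - 1))) (C := k) (by linarith)
      (neg_ne_zero.2 (mul_ne_zero (by omega) (by omega))) (by linarith)).and
    (eventually_ge_atTop 1))) |>.and
    (eventually_mul_pow_add_lt hb (u := 0) (v := e) (by linarith)
      (2 * (b ^ 3 * k)) (-(r * (r - 1)))))).exists
  obtain ⟨c, hc⟩ : (k : ℤ) ∣ j * (b : ℤ) ^ m - r := by
    have := Int.mul_ediv_add_emod ((j : ℤ) * (b : ℤ) ^ m) k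
    rw [hm] at this
    rw [← this, add_sub_assoc]
    exact dvd_add (Dvd.intro _ rfl) hrk
  have hXpos : (0 : ℤ) < (b : ℤ) ^ m := by positivity
  have hXm : (b : ℤ) ^ m = b * (b : ℤ) ^ (m - 1) := by
    rw [← pow_succ', Nat.sub_add_cancel hm1]
  have hc1 : (b : ℤ) ^ (m - 1) ≤ c := by
    have hb0 : (0 : ℤ) < b := by omega
    refine le_of_mul_le_mul_left ?_ (mul_pos hb0 (by omega : (0 : ℤ) < k))
    rw [mul_assoc (b : ℤ) k c, ← hc]
    have : (b : ℤ) * k * (b : ℤ) ^ (m - 1) = k * (b : ℤ) ^ m := by rw [hXm]; ring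
    linarith
  have hc2 : c < (b : ℤ) ^ m := by
    refine lt_of_mul_lt_mul_left ?_ (by omega : (0 : ℤ) ≤ k)
    rw [← hc]
    nlinarith
  have hc0 : 0 < c := lt_of_lt_of_le (by positivity) hc1
  lift c to ℕ using hc0.le
  have hlen : digLen b c = m :=
    digLen_eq_of_pow_le_of_lt hb hm1 (by exact_mod_cast hc1) (by exact_mod_cast hc2)
  have hlenk : digLen b k = 1 :=
    digLen_eq_of_pow_le_of_lt hb le_rfl (by simpa using hk) (by simpa using hkb)
  generalize hX : (b : ℤ) ^ m = X at *
  have hrun : run b [k, c] = ⟨c, c * k + 1, 1, k, k * X + c, 1 + m⟩ := by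
    simp [run, step, hlen, hlenk, hX]
  have hq : (c * k + 1 : ℤ) = j * X + -(r - 1) := by linear_combination -hc
  have hP : (k : ℤ) * (run b [k, c]).excess b = e * X + -(r * (r - 1)) := by
    rw [hrun]
    simp only [excess, pow_add, hX, pow_one, he]
    rw [hbz]
    linear_combination (-(r - 1)) * hc + (k : ℤ) * c * hc
  have hqpos : 0 < (j : ℤ) * X + -(r - 1) := by linarith
  refine ⟨[k, c], ?_, ?_⟩
  · simp; exact ⟨hk, by exact_mod_cast hc0⟩
  rw [← hq] at hqpos
  refine ⟨?_, ?_, ?_, ?_, ?_, ?_, ?_⟩ <;> generalize (run b [k, c]).excess b = P at * <;>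
    try simp only [hrun]
  · exact hqpos
  · ring
  · refine lt_of_mul_lt_mul_left ?_ (by omega : (0 : ℤ) ≤ k)
    rw [hq, mul_left_comm, hP]
    linarith
  · refine lt_of_mul_lt_mul_left ?_ (by omega : (0 : ℤ) ≤ k)
    rw [hq, hP]
    have h3 : e * X ≤ k * j * X := mul_le_mul_of_nonneg_right he2 hXpos.le
    have h4 : (k : ℤ) * (r - 1) < r * (r - 1) := mul_lt_mul_of_pos_right (by omega) (by omega)
    linarith
  · intro i hi
    rw [hq] at hi
    exact g4 i (by rwa [one_mul])
  · intro i hi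
    apply g5 i
    rw [← hP]
    exact mul_dvd_mul_left _ hi
  · refine lt_of_mul_lt_mul_left ?_ (by omega : (0 : ℤ) ≤ k)
    rw [mul_left_comm (k : ℤ) (_ + 1) P, hP, pow_add, hX]
    have hK : 0 < (b : ℤ) ^ 3 * k := by positivity
    calc (k : ℤ) * ((b : ℤ) ^ 2 * ((b : ℤ) ^ 1 * X)) = (b : ℤ) ^ 3 * k * X := by ring
      _ < (b : ℤ) ^ 3 * k * (2 * (c * k + 1)) := mul_lt_mul_of_pos_left (by linarith) hK
      _ = (c * k + 1) * (2 * ((b : ℤ) ^ 3 * k)) := by ring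
      _ < (c * k + 1) * (e * X + -(r * (r - 1))) := mul_lt_mul_of_pos_left (by linarith) hqpos

end CFState

theorem tsum_concat_digits_mem_Ioc {b : ℕ} (hb : 2 ≤ b) {a : ℕ → ℕ} (ha : ∀ i, 0 < a i) :
    ∑' i, (a i : ℝ) / (b : ℝ) ^ (∑ j ∈ Finset.range (i + 1), digLen b (a j)) ∈ Set.Ioc 0 1 := by
  have hb' : (0 : ℝ) < b := by exact_mod_cast (by omega : 0 < b)
  refine ⟨(summable_concat_digits hb a).tsum_pos (fun i => by positivity) 0 ?_,
    Real.tsum_le_of_sum_range_le (fun i => by positivity) (sum_concat_digits_le_one hb a)⟩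
  have : (0 : ℝ) < a 0 := by exact_mod_cast ha 0
  positivity

theorem tsum_concat_digits_eq {b : ℕ} (hb : 2 ≤ b) (a : ℕ → ℕ) :
    ∑' i, (a i : ℝ) / (b : ℝ) ^ (∑ j ∈ Finset.range (i + 1), digLen b (a j)) =
      (a 0 + ∑' i, (a (i + 1) : ℝ) / (b : ℝ) ^ (∑ j ∈ Finset.range (i + 1), digLen b (a (j + 1)))) /
        (b : ℝ) ^ digLen b (a 0) := by
  have hb' : (0 : ℝ) < b := by exact_mod_cast (by omega : 0 < b)
  rw [(summable_concat_digits hb a).tsum_eq_zero_add, add_div, ← tsum_div_const]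
  simp only [Finset.sum_range_succ' _ (_ + 1), pow_add, div_div]
  simp

theorem cfVal_mem_Icc {l : List ℕ} (hl : ∀ a ∈ l, 0 < a) : cfVal l ∈ Set.Icc 0 1 := by
  induction l with
  | nil => simp [cfVal]
  | cons c l ih =>
    obtain ⟨h1, -⟩ := ih fun a ha => hl a (by simp [ha])
    have hc : (1 : ℝ) ≤ c := by exact_mod_cast hl c (by simp)
    simp only [cfVal]
    exact ⟨by positivity, by rw [div_le_one] <;> linarith⟩

theorem exists_tendsto_cfVal_tail {a : ℕ → ℕ} (ha : ∀ i, 0 < a i) {x : ℝ}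
    (hx : Tendsto (fun n => cfVal ((List.range n).map a)) atTop (𝓝 x)) :
    ∃ y, Tendsto (fun n => cfVal ((List.range n).map fun i => a (i + 1))) atTop (𝓝 y) ∧
      x = 1 / (a 0 + y) ∧ 0 ≤ y := by
  have ha0 : (1 : ℝ) ≤ a 0 := by exact_mod_cast ha 0
  have hmem : ∀ n, cfVal ((List.range n).map fun i => a (i + 1)) ∈ Set.Icc 0 1 := fun n =>
    cfVal_mem_Icc (by simp [ha])
  have hsucc : ∀ n, cfVal ((List.range (n + 1)).map a) =
      1 / (a 0 + cfVal ((List.range n).map fun i => a (i + 1))) := by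
    intro n
    rw [List.range_succ_eq_map]
    simp [cfVal, Function.comp_def]
  have hx' := (tendsto_add_atTop_iff_nat 1).2 hx
  simp only [hsucc] at hx'
  have hx0 : 1 / ((a 0 : ℝ) + 1) ≤ x := ge_of_tendsto' hx' fun n => by
    have := hmem n
    exact one_div_le_one_div_of_le (by linarith [this.1]) (by linarith [this.2])
  have hxpos : 0 < x := lt_of_lt_of_le (by positivity) hx0
  have hy : Tendsto (fun n => cfVal ((List.range n).map fun i => a (i + 1))) atTop
      (𝓝 (x⁻¹ - a 0)) := by
    refine ((hx'.inv₀ hxpos.ne').sub_const (a 0 : ℝ)).congr fun n => ?_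
    simp
  refine ⟨_, hy, ?_, ge_of_tendsto' hy fun n => (hmem n).1⟩
  simp

theorem exists_tail_of_tendsto_cfVal {a : ℕ → ℕ} (ha : ∀ i, 0 < a i) {x : ℝ}
    (hx : Tendsto (fun n => cfVal ((List.range n).map a)) atTop (𝓝 x)) :
    ∃ y, Tendsto (fun n => cfVal ((List.range n).map fun i => a (i + 1))) atTop (𝓝 y) ∧
      x = 1 / (a 0 + y) ∧ 0 < y := by
  obtain ⟨y, hy, hxy, -⟩ := exists_tendsto_cfVal_tail ha hx
  obtain ⟨w, -, hyw, hw⟩ := exists_tendsto_cfVal_tail (fun i => ha (i + 1)) hy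
  have ha1 : (0 : ℝ) < a (0 + 1) := by exact_mod_cast ha _
  exact ⟨y, hy, hxy, by rw [hyw]; positivity⟩

theorem mem_Gamma_of_isTrottWith {b : ℕ} (hb : 2 ≤ b) {x : ℝ} {a : ℕ → ℕ}
    (h : IsTrottWith b x a) : b ∈ Gamma := by
  obtain ⟨ha, hcf, hdig⟩ := h
  obtain ⟨y, hy, hxy, hy0⟩ := exists_tail_of_tendsto_cfVal ha hcf
  obtain ⟨w, -, hyw, hw0⟩ := exists_tail_of_tendsto_cfVal (fun i => ha (i + 1)) hy
  rw [tsum_concat_digits_eq hb] at hdig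
  obtain ⟨hz0, hz1⟩ := tsum_concat_digits_mem_Ioc hb fun i => ha (i + 1)
  have hzv := tsum_concat_digits_eq hb fun i => a (i + 1)
  obtain ⟨-, hv1⟩ := tsum_concat_digits_mem_Ioc hb fun i => ha (i + 1 + 1)
  generalize ∑' i, (a (i + 1) : ℝ) / (b : ℝ) ^ (∑ j ∈ Finset.range (i + 1), digLen b (a (j + 1)))
    = z at *
  generalize ∑' i, (a (i + 1 + 1) : ℝ) /
    (b : ℝ) ^ (∑ j ∈ Finset.range (i + 1), digLen b (a (j + 1 + 1))) = v at *
  have hk := ha 0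
  have hA := ha (0 + 1)
  generalize a (0 + 1) = A at *
  generalize a 0 = k at *
  have hA1 : (1 : ℝ) ≤ A := by exact_mod_cast hA
  have hk1 : (1 : ℝ) ≤ k := by exact_mod_cast hk
  have hb2 : (2 : ℝ) ≤ b := by exact_mod_cast hb
  have hyA : y * (A + w) = 1 := by rw [hyw]; field_simp
  have hy1 : y < 1 := by nlinarith
  have hprod : (k + y) * (k + z) = (b : ℝ) ^ digLen b k := by
    have h1 := hxy.symm.trans hdig
    field_simp at h1
    linarith
  have hlen : digLen b k = 1 := by
    have h1 := digLen_pos (b := b) hk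
    have h2 : b ^ (digLen b k - 1) ≤ k :=
      (Nat.lt_digits_length_iff (by omega : 1 < b) k).1 (by unfold digLen at *; omega)
    have h3 : (b : ℝ) ^ (digLen b k - 1) ≤ k := by exact_mod_cast h2
    by_contra hne
    obtain ⟨n, hn⟩ : ∃ n, digLen b k = n + 2 := ⟨digLen b k - 2, by omega⟩
    rw [hn] at h3 hprod
    have h4 : (b : ℝ) ^ (n + 2) ≤ (b : ℝ) ^ (n + 1) * (b : ℝ) ^ (n + 1) := by
      rw [← pow_add]
      exact pow_le_pow_right₀ (by linarith) (by omega)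
    have h5 : (0 : ℝ) < (b : ℝ) ^ (n + 1) := by positivity
    simp only [Nat.add_succ_sub_one] at h3
    nlinarith
  rw [hlen, pow_one] at hprod
  have hlo : k ^ 2 < b := by
    have : (k : ℝ) ^ 2 < b := by nlinarith
    exact_mod_cast this
  rcases Nat.lt_or_ge k 2 with hk2 | hk2
  · obtain rfl : k = 1 := by omega
    have : (b : ℝ) < 4 := by push_cast at *; nlinarith
    have hb4 : b < 4 := by exact_mod_cast this
    interval_cases b
    · exact Or.inr ⟨1, by norm_num⟩
    · exact Or.inl rfl
  refine Or.inr ⟨k, by omega, hlo, ?_⟩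
  by_contra! hc
  have hcr : (k : ℝ) ^ 2 + k + 1 ≤ b := by exact_mod_cast hc
  have hk2r : (2 : ℝ) ≤ k := by exact_mod_cast hk2
  have hyk : 1 ≤ y * (k + 1) := by nlinarith
  have hAk : (A : ℝ) < k + 1 := by nlinarith
  have hzA : b * z ≤ A + 1 := by
    have h1 := digLen_pos (b := b) hA
    have h2 : (b : ℝ) ≤ (b : ℝ) ^ digLen b A := le_self_pow₀ (by linarith) h1.ne'
    have h3 : z * (b : ℝ) ^ digLen b A = A + v := by rw [hzv]; field_simp
    nlinarith
  have hAk' : A ≤ k := by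
    have : A < k + 1 := by exact_mod_cast hAk
    omega
  have hexp : k * y + k * z + y * z ≥ k + 1 := by nlinarith
  rcases Nat.lt_or_ge A 2 with hA2 | hA2
  · obtain rfl : A = 1 := by omega
    have h1 : 1 < (k + 1) * z := by nlinarith
    push_cast at hzA
    nlinarith
  · have hA2r : (2 : ℝ) ≤ A := by exact_mod_cast hA2
    have hAkr : (A : ℝ) ≤ k := by exact_mod_cast hAk'
    have hyhalf : y < 1 / 2 := by nlinarith
    have h1 : k / 2 + 1 < (k + 1 / 2) * z := by nlinarith
    have h2 : b * z ≤ k + 1 := by linarith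
    have h3 : (k ^ 2 + k + 1) * z ≤ k + 1 :=
      (mul_le_mul_of_nonneg_right hcr hz0.le).trans h2
    have h4 : k * z < 1 := by
      refine lt_of_mul_lt_mul_left ?_ (by linarith : (0 : ℝ) ≤ k + 1)
      linarith
    have h5 : 2 * z ≤ k * z := mul_le_mul_of_nonneg_right hk2r hz0.le
    linarith

/-- Trott numbers in base `b` exist if and only if `b ∈ Γ`. -/
theorem trottSet_nonempty_iff (b : ℕ) (hb : 2 ≤ b) :
    (TrottSet b).Nonempty ↔ b ∈ Gamma := by
  constructor
  · rintro ⟨x, a, ha⟩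
    exact mem_Gamma_of_isTrottWith hb ha
  · rintro (rfl | ⟨k, hk, h1, h2⟩)
    · exact CFState.trottSet_nonempty_of_extendable hb (by simp) CFState.extendable_base_three
    · obtain ⟨l, hl, hext⟩ := CFState.exists_extendable_of_sq_lt hk h1 h2
      exact CFState.trottSet_nonempty_of_extendable hb hl hext
end

section
/- Let b ≥ 2 be an integer with b ∈ Γ. Then the set T_b of Trott numbers in base b is uncountable. -/
open Filter Topology

/-- If `B ≠ 0`, the `b`-part of the integers `b ^ l * u + B` is bounded as `l` grows. -/
theorem exists_pow_dvd_bound (b : ℕ) (hb : 2 ≤ b) (B : ℤ) (hB : B ≠ 0) :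
    ∃ c : ℕ, ∀ l, c < l → ∀ u Q : ℤ, Q = (b : ℤ) ^ l * u + B →
      ∀ (m : ℕ) (w : ℤ), Q ∣ (b : ℤ) ^ m * w → Q ∣ (b : ℤ) ^ c * w := by
  obtain ⟨c, hc⟩ : ∃ c : ℕ, Int.gcd B ((b : ℤ) ^ (c + 1)) ≤ Int.gcd B ((b : ℤ) ^ c) := by
    by_contra! h
    have hmono : ∀ n : ℕ, n ≤ Int.gcd B ((b : ℤ) ^ n) := by
      intro n
      induction n with
      | zero => exact Nat.zero_le _
      | succ n ih => exact lt_of_le_of_lt ih (h n)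
    have h1 := hmono (B.natAbs + 1)
    have h2 : Int.gcd B ((b : ℤ) ^ (B.natAbs + 1)) ≤ B.natAbs :=
      Nat.le_of_dvd (Int.natAbs_pos.mpr hB) (Int.gcd_dvd_natAbs_left _ _)
    omega
  refine ⟨c, fun l hl u Q hQ m w hdvd => ?_⟩
  have hgcd : ∀ i ≤ l, Int.gcd Q ((b : ℤ) ^ i) = Int.gcd B ((b : ℤ) ^ i) := by
    intro i hi
    obtain ⟨j, rfl⟩ := Nat.exists_eq_add_of_le hi
    rw [hQ, pow_add, mul_assoc, add_comm, Int.gcd_comm, Int.gcd_comm B]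
    simp
  have hbpos : (0 : ℤ) < b := by exact_mod_cast (by omega : 0 < b)
  have hgpos : 0 < Int.gcd Q ((b : ℤ) ^ c) := Int.gcd_pos_of_ne_zero_right _ (by positivity)
  obtain ⟨v, hv⟩ : (Int.gcd Q ((b : ℤ) ^ c) : ℤ) ∣ Q := Int.gcd_dvd_left _ _
  obtain ⟨f, hf⟩ : (Int.gcd Q ((b : ℤ) ^ c) : ℤ) ∣ (b : ℤ) ^ c := Int.gcd_dvd_right _ _
  have hle : Int.gcd Q ((b : ℤ) ^ (c + 1)) ≤ Int.gcd Q ((b : ℤ) ^ c) := by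
    rw [hgcd _ (by omega), hgcd _ (by omega)]; exact hc
  generalize Int.gcd Q ((b : ℤ) ^ c) = g at *
  have hcop : IsCoprime v (b : ℤ) := by
    rw [Int.isCoprime_iff_gcd_eq_one]
    have h1 : Int.gcd Q ((b : ℤ) ^ (c + 1)) = g * Int.gcd v (f * b) := by
      rw [pow_succ, hf, hv, mul_assoc, Int.gcd_mul_left]; simp
    have h2 : Int.gcd v b ∣ Int.gcd v (f * b) :=
      Int.gcd_dvd_gcd_mul_left_right _ _ _
    have h3 : Int.gcd v (f * b) ≤ 1 := by
      rw [h1] at hle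
      by_contra! h
      nlinarith
    have h4 : 0 < Int.gcd v (f * b) := by
      apply Int.gcd_pos_of_ne_zero_right
      have : f ≠ 0 := by
        rintro rfl
        have : (b : ℤ) ^ c ≠ 0 := by positivity
        simp [hf] at this
      positivity
    have h5 : Int.gcd v (f * b) = 1 := by omega
    rw [h5] at h2
    exact Nat.dvd_one.mp h2
  have hvw : v ∣ w :=
    (hcop.pow_right (n := m)).dvd_of_dvd_mul_left ((Dvd.intro_left _ hv.symm).trans hdvd)
  rw [hv, hf, mul_assoc]
  exact mul_dvd_mul_left _ (hvw.mul_left _)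

/-- Powers of `b` modulo `Q` recur once the `b`-part of `Q` has been exhausted. -/
theorem frequently_dvd_pow_sub_pow (b : ℕ) (Q : ℤ) (hQ : 0 < Q) (c : ℕ)
    (h : ∀ (m : ℕ) (w : ℤ), Q ∣ (b : ℤ) ^ m * w → Q ∣ (b : ℤ) ^ c * w) (i : ℕ) (hi : c ≤ i) :
    ∃ᶠ l in atTop, Q ∣ (b : ℤ) ^ l - (b : ℤ) ^ i := by
  obtain ⟨x, p, hp, hxp⟩ : ∃ x p : ℕ, 0 < p ∧ Q ∣ (b : ℤ) ^ x * ((b : ℤ) ^ p - 1) := by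
    lift Q to ℕ using hQ.le
    have : NeZero Q := ⟨by omega⟩
    obtain ⟨x, y, hxy, hne⟩ := Finite.exists_ne_map_eq_of_infinite (fun n : ℕ => ((b : ZMod Q)) ^ n)
    wlog hlt : x < y generalizing x y
    · exact this y x hxy.symm hne.symm (by omega)
    refine ⟨x, y - x, by omega, ?_⟩
    rw [← ZMod.intCast_zmod_eq_zero_iff_dvd]
    push_cast
    rw [mul_sub, ← pow_add, Nat.add_sub_cancel' hlt.le]
    simpa [sub_eq_zero] using hne.symm
  have hcp : Q ∣ (b : ℤ) ^ c * ((b : ℤ) ^ p - 1) := h _ _ hxp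
  rw [frequently_atTop]
  intro n
  refine ⟨i + p * n, by nlinarith, ?_⟩
  have h1 : (b : ℤ) ^ (i + p * n) - (b : ℤ) ^ i
      = (b : ℤ) ^ (i - c) * ((b : ℤ) ^ c * (((b : ℤ) ^ p) ^ n - 1)) := by
    rw [← mul_assoc, ← pow_add, Nat.sub_add_cancel hi, pow_add, pow_mul]; ring
  rw [h1]
  apply Dvd.dvd.mul_left
  refine hcp.trans (mul_dvd_mul_left _ ?_)
  simpa using sub_dvd_pow_sub_pow ((b : ℤ) ^ p) 1 n

/-- A real number without terminating base-`b` expansion has infinitely many nonzero digits. -/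
theorem exists_shift_mem_Ioo (b : ℕ) (hb : 2 ≤ b) (Y : ℝ)
    (hY : ∀ (m : ℕ) (z : ℤ), (b : ℝ) ^ m * Y ≠ z) (c : ℕ) :
    ∃ i, c ≤ i ∧ ∃ z : ℤ, 1 / (b : ℝ) < (b : ℝ) ^ i * Y - z ∧ (b : ℝ) ^ i * Y - z < 1 := by
  by_contra! hno
  have hb' : (2 : ℝ) ≤ b := by exact_mod_cast hb
  have hpos : ∀ i, 0 < Int.fract ((b : ℝ) ^ i * Y) := fun i =>
    lt_of_le_of_ne (Int.fract_nonneg _) fun h0 =>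
      hY i ⌊(b : ℝ) ^ i * Y⌋ (by have := Int.self_sub_floor ((b : ℝ) ^ i * Y); linarith)
  have hgrow : ∀ n, (b : ℝ) ^ n * Int.fract ((b : ℝ) ^ c * Y)
      = Int.fract ((b : ℝ) ^ (c + n) * Y) := by
    intro n
    induction n with
    | zero => simp
    | succ n ih =>
      have hle : Int.fract ((b : ℝ) ^ (c + n) * Y) ≤ 1 / b := by
        by_contra! hlt
        have := hno (c + n) (by omega) ⌊(b : ℝ) ^ (c + n) * Y⌋ hlt
        exact absurd (Int.fract_lt_one ((b : ℝ) ^ (c + n) * Y)) (not_lt.mpr this)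
      have hle1 : (b : ℝ) * Int.fract ((b : ℝ) ^ (c + n) * Y) ≤ 1 := by
        rw [le_div_iff₀ (by linarith)] at hle; linarith
      have heq : (b : ℝ) ^ (c + (n + 1)) * Y
          = b * Int.fract ((b : ℝ) ^ (c + n) * Y) + ((b * ⌊(b : ℝ) ^ (c + n) * Y⌋ : ℤ) : ℝ) := by
        push_cast
        rw [← mul_add, Int.fract_add_floor]; ring
      have hlt1 : (b : ℝ) * Int.fract ((b : ℝ) ^ (c + n) * Y) < 1 := by
        refine lt_of_le_of_ne hle1 fun h1 => ?_
        apply hY (c + (n + 1)) (1 + b * ⌊(b : ℝ) ^ (c + n) * Y⌋)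
        rw [heq, h1]; push_cast; ring
      rw [pow_succ', mul_assoc, ih, heq, Int.fract_add_intCast, eq_comm, Int.fract_eq_self]
      exact ⟨mul_nonneg (by linarith) (hpos _).le, hlt1⟩
  obtain ⟨n, hn⟩ := pow_unbounded_of_one_lt (1 / Int.fract ((b : ℝ) ^ c * Y))
    (by linarith : (1 : ℝ) < b)
  rw [div_lt_iff₀ (hpos c), hgrow] at hn
  exact absurd hn (not_lt.mpr (Int.fract_lt_one _).le)

theorem exists_two_shifts_mem_Ioo (b : ℕ) (hb : 2 ≤ b) (y : ℕ → ℝ) (Y G : ℝ)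
    (hG : Tendsto (fun l => (b : ℝ) ^ l * (y l - Y)) atTop (𝓝 G))
    (hyY : Tendsto y atTop (𝓝 Y))
    (halt : (∀ (m : ℕ) (z : ℤ), (b : ℝ) ^ m * Y ≠ z) ∨ G < 0) (c : ℕ) :
    ∃ η > 0, ∃ d ≥ 1, ∀ᶠ l in atTop, ∃ i ≥ c, ∃ z₁ z₂ : ℤ,
      (b : ℝ) ^ i * y l - z₁ ∈ Set.Ioo (1 / (b : ℝ) + η) (1 - η) ∧
      (b : ℝ) ^ (i + d) * y l - z₂ ∈ Set.Ioo (1 / (b : ℝ) + η) (1 - η) := by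
  have hb' : (2 : ℝ) ≤ b := by exact_mod_cast hb
  by_cases hY : ∀ (m : ℕ) (z : ℤ), (b : ℝ) ^ m * Y ≠ z
  · obtain ⟨i, hi, z₁, h1, h1'⟩ := exists_shift_mem_Ioo b hb Y hY c
    obtain ⟨j, hj, z₂, h2, h2'⟩ := exists_shift_mem_Ioo b hb Y hY (i + 1)
    obtain ⟨d, rfl⟩ := Nat.exists_eq_add_of_le (show i ≤ j by omega)
    obtain ⟨η, hη, hη'⟩ := exists_between (show 0 < min
      (min ((b : ℝ) ^ i * Y - z₁ - 1 / b) (1 - ((b : ℝ) ^ i * Y - z₁)))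
      (min ((b : ℝ) ^ (i + d) * Y - z₂ - 1 / b) (1 - ((b : ℝ) ^ (i + d) * Y - z₂))) by
        simp only [lt_min_iff]; refine ⟨⟨?_, ?_⟩, ?_, ?_⟩ <;> linarith)
    simp only [lt_min_iff] at hη'
    refine ⟨η, hη, d, by omega, ?_⟩
    have t1 : Tendsto (fun l => (b : ℝ) ^ i * y l - z₁) atTop (𝓝 ((b : ℝ) ^ i * Y - z₁)) :=
      (hyY.const_mul _).sub_const _
    have t2 : Tendsto (fun l => (b : ℝ) ^ (i + d) * y l - z₂) atTop
        (𝓝 ((b : ℝ) ^ (i + d) * Y - z₂)) := (hyY.const_mul _).sub_const _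
    filter_upwards [t1 (Ioo_mem_nhds (show 1 / (b : ℝ) + η < _ by linarith)
      (show _ < 1 - η by linarith)), t2 (Ioo_mem_nhds (show 1 / (b : ℝ) + η < _ by linarith)
      (show _ < 1 - η by linarith))] with l e1 e2
    exact ⟨i, hi, z₁, z₂, e1, e2⟩
  · have hGneg : G < 0 := halt.resolve_left hY
    push Not at hY
    obtain ⟨m, z, hz⟩ := hY
    have hinv : 1 / (b : ℝ) ≤ 1 / 2 := one_div_le_one_div_of_le (by norm_num) hb'
    obtain ⟨h, hh⟩ := pow_unbounded_of_one_lt (4 * (-G)) (by linarith : (1 : ℝ) < b)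
    have hinteger : ∀ k, ∃ w : ℤ, (b : ℝ) ^ (m + k) * Y = w := fun k =>
      ⟨b ^ k * z, by push_cast; rw [← hz]; ring⟩
    have key : ∀ n ≥ h, -(1 / 4) < G / (b : ℝ) ^ n ∧ G / (b : ℝ) ^ n < 0 := by
      intro n hn
      have hp : (b : ℝ) ^ h ≤ (b : ℝ) ^ n := pow_le_pow_right₀ (by linarith) hn
      have hpos : 0 < (b : ℝ) ^ n := by positivity
      exact ⟨by rw [lt_div_iff₀ hpos]; linarith, div_neg_of_neg_of_pos hGneg hpos⟩
    have k1 := key (h + 1) (by omega)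
    have k2 := key h le_rfl
    obtain ⟨η, hη, hη'⟩ := exists_between (show 0 < min (1 / 4 : ℝ)
      (min (-(G / (b : ℝ) ^ (h + 1))) (-(G / (b : ℝ) ^ h))) by
        simp only [lt_min_iff]; refine ⟨?_, ?_, ?_⟩ <;> linarith)
    simp only [lt_min_iff] at hη'
    have t : ∀ n, Tendsto (fun l => (b : ℝ) ^ l * (y l - Y) / (b : ℝ) ^ n + 1) atTop
      (𝓝 (G / (b : ℝ) ^ n + 1)) := fun n => (hG.div_const _).add_const _
    refine ⟨η, hη, 1, le_rfl, ?_⟩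
    filter_upwards [t (h + 1) (Ioo_mem_nhds (show 1 / (b : ℝ) + η < _ by linarith)
      (show _ < 1 - η by linarith)), t h (Ioo_mem_nhds (show 1 / (b : ℝ) + η < _ by linarith)
      (show _ < 1 - η by linarith)), eventually_ge_atTop (c + m + h + 1)] with l e1 e2 hl
    obtain ⟨k, rfl⟩ := Nat.exists_eq_add_of_le hl
    obtain ⟨w₁, hw₁⟩ := hinteger (c + k)
    obtain ⟨w₂, hw₂⟩ := hinteger (c + k + 1)
    have hb0 : (b : ℝ) ≠ 0 := by positivity
    rw [Set.mem_preimage] at e1 e2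
    generalize y (c + m + h + 1 + k) = v at *
    refine ⟨m + (c + k), by omega, w₁ - 1, w₂ - 1, ?_, ?_⟩
    · convert e1 using 1
      push_cast
      rw [← hw₁]
      field_simp
      ring
    · convert e2 using 1
      push_cast
      rw [← hw₂]
      field_simp
      ring

/-- State of the construction of a Trott number after a finite string of partial quotients:
`q` and `qm` are the denominators of the last two convergents, `u / q` and `um / qm` are the
positions of these convergents relative to the base-`b` interval of the string (of length
`b ^ (-e)`), `ε` is the sign of the determinant, and `κ` is a recurring residue of `b ^ l * u`
modulo `q`. Appending a partial quotient with `l` digits moves the position to approximately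
`(κ - ε * b ^ e / u) / q`. -/
structure Viable (b : ℕ) (q qm u um ε κ : ℤ) (e : ℕ) : Prop where
  sign : ε = 1 ∨ ε = -1
  q_pos : 0 < q
  u_pos : 0 < u
  u_le : u ≤ q
  q_lt : q < b * u
  u_lt_or : u < q ∨ 0 < κ
  det : u * qm - um * q = ε * (b : ℤ) ^ e
  ne : qm ≠ κ
  lim_gt : 1 / (b : ℝ) < ((κ : ℝ) - ε * (b : ℝ) ^ e / u) / q
  lim_le : ((κ : ℝ) - ε * (b : ℝ) ^ e / u) / q ≤ 1
  alt : (∀ (m : ℕ) (z : ℤ), (b : ℝ) ^ m * (((κ : ℝ) - ε * (b : ℝ) ^ e / u) / q) ≠ z) ∨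
    ε * (qm - κ) < 0
  freq : ∃ᶠ l in atTop, q ∣ (b : ℤ) ^ l * u - κ

theorem tendsto_pow_div_affine (b : ℕ) (hb : 2 ≤ b) (u B : ℝ) (hu : 0 < u) :
    Tendsto (fun l : ℕ => (b : ℝ) ^ l / ((b : ℝ) ^ l * u + B)) atTop (𝓝 (1 / u)) := by
  have hb' : (2 : ℝ) ≤ b := by exact_mod_cast hb
  have h1 : Tendsto (fun l : ℕ => 1 / (u + B * (1 / (b : ℝ)) ^ l)) atTop
      (𝓝 (1 / (u + B * 0))) := by
    refine Tendsto.div tendsto_const_nhds (tendsto_const_nhds.add (Tendsto.const_mul _ ?_))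
      (by simpa using hu.ne')
    refine tendsto_pow_atTop_nhds_zero_of_lt_one (by positivity) ?_
    rw [div_lt_one (by linarith)]; linarith
  rw [mul_zero, add_zero] at h1
  refine h1.congr fun l => ?_
  have hp : (b : ℝ) ^ l ≠ 0 := by positivity
  rw [one_div_pow, show (b : ℝ) ^ l * u + B = (b : ℝ) ^ l * (u + B * (1 / (b : ℝ) ^ l)) by
    field_simp, div_mul_eq_div_div, div_self hp]

/-- At least one of two residues whose exponents differ by `d` is viable. -/
theorem exists_viable_of_two_shifts (b : ℕ) (hb : 2 ≤ b) {Q q U κ ε : ℤ} {e c i d : ℕ} {η : ℝ}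
    {z₁ z₂ : ℤ} (hsign : ε = 1 ∨ ε = -1) (hU : 0 < U) (hUQ : U < Q) (hQU : Q < b * U)
    (hdet : U * q - κ * Q = ε * (b : ℤ) ^ e)
    (hbig : (b : ℤ) ^ (c + d) < Q) (hqQ : b * q < Q) (hd : 1 ≤ d)
    (hη : (b : ℝ) ^ e / (U * Q) < η) (hi : c ≤ i)
    (hc : ∀ (m : ℕ) (w : ℤ), Q ∣ (b : ℤ) ^ m * w → Q ∣ (b : ℤ) ^ c * w)
    (h₁ : (b : ℝ) ^ i * ((U : ℝ) / Q) - z₁ ∈ Set.Ioo (1 / (b : ℝ) + η) (1 - η))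
    (h₂ : (b : ℝ) ^ (i + d) * ((U : ℝ) / Q) - z₂ ∈ Set.Ioo (1 / (b : ℝ) + η) (1 - η)) :
    ∃ κ', Viable b Q q U κ ε κ' e := by
  have hQ : 0 < Q := hU.trans hUQ
  have hQR : (0 : ℝ) < Q := by exact_mod_cast hQ
  have hUR : (0 : ℝ) < U := by exact_mod_cast hU
  have hb' : (2 : ℝ) ≤ b := by exact_mod_cast hb
  have hbz : (2 : ℤ) ≤ b := by exact_mod_cast hb
  have hηpos : 0 < η := lt_of_le_of_lt (by positivity) hη
  have mk : ∀ (j : ℕ) (z : ℤ), c ≤ j →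
      (b : ℝ) ^ j * ((U : ℝ) / Q) - z ∈ Set.Ioo (1 / (b : ℝ) + η) (1 - η) →
      (∀ (m : ℕ) (w : ℤ), (b : ℝ) ^ m *
        ((((b ^ j * U - z * Q : ℤ) : ℝ) - ε * (b : ℝ) ^ e / U) / Q) ≠ w) →
      Viable b Q q U κ ε (b ^ j * U - z * Q) e := by
    intro j z hj hmem hnt
    have hpos : (((b ^ j * U - z * Q : ℤ) : ℝ)) / Q = (b : ℝ) ^ j * ((U : ℝ) / Q) - z := by
      push_cast; field_simp
    have hsplit : (((b ^ j * U - z * Q : ℤ) : ℝ) - ε * (b : ℝ) ^ e / U) / Q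
        = ((b : ℝ) ^ j * ((U : ℝ) / Q) - z) - ε * ((b : ℝ) ^ e / (U * Q)) := by
      rw [sub_div, hpos]; field_simp
    have habs : |(ε : ℝ) * ((b : ℝ) ^ e / (U * Q))| < η := by
      rw [abs_mul, abs_of_nonneg (by positivity : 0 ≤ (b : ℝ) ^ e / (U * Q))]
      rcases hsign with rfl | rfl <;> simpa using hη
    rw [abs_lt] at habs
    obtain ⟨m1, m2⟩ := hmem
    refine ⟨hsign, hQ, hU, hUQ.le, hQU, Or.inl hUQ, hdet, ?_, ?_, ?_, Or.inl hnt, ?_⟩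
    · intro heq
      rw [← hpos, ← heq] at m1
      have h1 : 1 / (b : ℝ) < q / Q := by linarith
      rw [div_lt_div_iff₀ (by linarith) hQR] at h1
      have h2 : (b : ℝ) * q < Q := by exact_mod_cast hqQ
      linarith
    · rw [hsplit]; linarith
    · rw [hsplit]; linarith
    · refine (frequently_dvd_pow_sub_pow b Q hQ c hc j hj).mono fun l hl => ?_
      rw [show (b : ℤ) ^ l * U - (b ^ j * U - z * Q)
        = ((b : ℤ) ^ l - b ^ j) * U + z * Q by ring]
      exact (hl.mul_right _).add (Dvd.intro_left _ rfl)
  by_contra! hno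
  have t1 := mt (mk i z₁ hi h₁) (hno _)
  have t2 := mt (mk (i + d) z₂ (by omega) h₂) (hno _)
  push Not at t1 t2
  obtain ⟨m₁, w₁, e₁⟩ := t1
  obtain ⟨m₂, w₂, e₂⟩ := t2
  have hdiff : (b : ℤ) ^ (m₁ + m₂) * ((b ^ (i + d) * U - z₂ * Q) - (b ^ i * U - z₁ * Q))
      = Q * (b ^ m₁ * w₂ - b ^ m₂ * w₁) := by
    have : ((b : ℝ) ^ (m₁ + m₂) * ((b ^ (i + d) * U - z₂ * Q) - (b ^ i * U - z₁ * Q)))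
      = Q * (b ^ m₁ * w₂ - b ^ m₂ * w₁) := by
      rw [← e₁, ← e₂]
      push_cast
      field_simp
      ring
    exact_mod_cast this
  have hdvd : Q ∣ (b : ℤ) ^ (m₁ + m₂ + i + e) * ((b : ℤ) ^ d - 1) := by
    have hs : ε * ε = 1 := by rcases hsign with rfl | rfl <;> norm_num
    refine ⟨ε * (q * ((b ^ m₁ * w₂ - b ^ m₂ * w₁) + b ^ (m₁ + m₂) * (z₂ - z₁))
      - κ * b ^ (m₁ + m₂ + i) * (b ^ d - 1)), ?_⟩
    have hpe : (b : ℤ) ^ e = ε * (U * q - κ * Q) := by rw [hdet, ← mul_assoc, hs, one_mul]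
    have : (b : ℤ) ^ (m₁ + m₂ + i) * (b ^ d - 1) * U
        = Q * ((b ^ m₁ * w₂ - b ^ m₂ * w₁) + b ^ (m₁ + m₂) * (z₂ - z₁)) := by
      rw [mul_add, ← hdiff]; ring
    calc (b : ℤ) ^ (m₁ + m₂ + i + e) * ((b : ℤ) ^ d - 1)
        = ε * (q * ((b : ℤ) ^ (m₁ + m₂ + i) * (b ^ d - 1) * U)
          - κ * Q * b ^ (m₁ + m₂ + i) * (b ^ d - 1)) := by
          rw [pow_add _ _ e, hpe]; ring
      _ = _ := by rw [this]; ring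
  have hle := Int.le_of_dvd (mul_pos (by positivity)
    (sub_pos.mpr (one_lt_pow₀ (by linarith) (by omega)))) (hc _ _ hdvd)
  have : (0 : ℤ) < (b : ℤ) ^ c := by positivity
  rw [pow_add] at hbig
  nlinarith

/-- Viability is inherited when a sufficiently long partial quotient is appended. -/
theorem Viable.step {b : ℕ} (hb : 2 ≤ b) {q qm u um ε κ : ℤ} {e : ℕ}
    (h : Viable b q qm u um ε κ e) :
    ∀ᶠ l in atTop, ∀ a : ℤ, a * q = (b : ℤ) ^ l * u - κ →
      ∃ κ', Viable b (a * q + qm) q (a * (κ - qm) + (b : ℤ) ^ l * um) κ (-ε) κ' (e + l) := by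
  have hb' : (2 : ℝ) ≤ b := by exact_mod_cast hb
  have hqR : (0 : ℝ) < q := by exact_mod_cast h.q_pos
  have huR : (0 : ℝ) < u := by exact_mod_cast h.u_pos
  have hB : qm - κ ≠ 0 := sub_ne_zero.mpr h.ne
  obtain ⟨c, hc⟩ := exists_pow_dvd_bound b hb (qm - κ) hB
  set B : ℝ := (qm : ℝ) - κ with hBdef
  set D : ℝ := ε * (b : ℝ) ^ e with hD
  set Y : ℝ := ((κ : ℝ) - D / u) / q with hY
  set den : ℕ → ℝ := fun l => (b : ℝ) ^ l * u + B with hden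
  set r : ℕ → ℝ := fun l => (b : ℝ) ^ l / den l with hr
  set y : ℕ → ℝ := fun l => κ / q - D / q * r l with hy
  have tr : Tendsto r atTop (𝓝 (1 / u)) := tendsto_pow_div_affine b hb u B huR
  have tden : Tendsto den atTop atTop :=
    tendsto_atTop_add_const_right _ _
      ((tendsto_pow_atTop_atTop_of_one_lt (by linarith)).atTop_mul_const huR)
  have ty : Tendsto y atTop (𝓝 Y) := by
    have : Y = κ / q - D / q * (1 / u) := by rw [hY]; field_simp
    rw [this]
    exact (tr.const_mul _).const_sub _
  have hdiff : ∀ l, den l ≠ 0 → (b : ℝ) ^ l * (y l - Y) = D * B / (q * u) * r l := by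
    intro l hl
    simp only [hy, hY, hr]
    field_simp
    simp only [hden]
    ring
  have tG : Tendsto (fun l => (b : ℝ) ^ l * (y l - Y)) atTop (𝓝 (D * B / (q * u) * (1 / u))) := by
    refine (tr.const_mul _).congr' ?_
    filter_upwards [tden.eventually_gt_atTop 0] with l hl
    exact (hdiff l hl.ne').symm
  have hneg : ε * (qm - κ) < 0 → D * B / (q * u) < 0 := by
    intro hlt
    apply div_neg_of_neg_of_pos _ (by positivity)
    have : (ε : ℝ) * B < 0 := by rw [hBdef]; exact_mod_cast hlt
    have hp : (0 : ℝ) < (b : ℝ) ^ e := by positivity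
    rw [hD]
    nlinarith
  have halt : (∀ (m : ℕ) (z : ℤ), (b : ℝ) ^ m * Y ≠ z) ∨ D * B / (q * u) * (1 / u) < 0 :=
    h.alt.imp_right fun hlt => mul_neg_of_neg_of_pos (hneg hlt) (by positivity)
  obtain ⟨η, hη, d, hd, hshift⟩ := exists_two_shifts_mem_Ioo b hb y Y _ tG ty halt c
  have hylt : ∀ᶠ l in atTop, y l < 1 := by
    rcases h.lim_le.lt_or_eq with hlt | heq
    · exact ty.eventually_lt_const hlt
    · have hlt : ε * (qm - κ) < 0 := h.alt.resolve_left fun hall => hall 0 1 (by simpa using heq)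
      filter_upwards [tden.eventually_gt_atTop 0] with l hl
      have h1 := hdiff l hl.ne'
      have h2 : 0 < r l := div_pos (by positivity) hl
      have h3 : (b : ℝ) ^ l * (y l - Y) < 0 := h1 ▸ mul_neg_of_neg_of_pos (hneg hlt) h2
      have h4 : y l - Y < 0 := by
        by_contra! hge
        exact absurd h3 (not_lt.mpr (by positivity))
      have h5 : Y = 1 := heq
      linarith
  have tsmall : Tendsto (fun l => (b : ℝ) ^ e * r l * b / den l) atTop (𝓝 0) :=
    ((tr.const_mul _).mul_const _).div_atTop tden
  filter_upwards [hshift, hylt, ty.eventually_const_lt h.lim_gt, tden.eventually_gt_atTop 0,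
    tden.eventually_gt_atTop ((b : ℝ) ^ (c + d)), tden.eventually_gt_atTop ((b : ℝ) * q),
    tsmall.eventually_lt_const hη, eventually_gt_atTop c]
    with l ⟨i, hi, z₁, z₂, h₁, h₂⟩ hy1 hyb hden0 hden1 hden2 hsm hl a ha
  have hQ : a * q + qm = (b : ℤ) ^ l * u + (qm - κ) := by rw [ha]; ring
  have hdet : (a * (κ - qm) + (b : ℤ) ^ l * um) * q - κ * (a * q + qm)
      = -ε * (b : ℤ) ^ (e + l) := by
    rw [pow_add]
    linear_combination (-qm) * ha - (b : ℤ) ^ l * h.det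
  have hQR : ((a * q + qm : ℤ) : ℝ) = den l := by rw [hQ]; push_cast; simp [hden, hBdef]
  generalize a * q + qm = Q at *
  generalize a * (κ - qm) + (b : ℤ) ^ l * um = U at *
  have hyU : y l = (U : ℝ) / Q := by
    have hdetR : (U : ℝ) * q - κ * Q = -ε * (b : ℝ) ^ (e + l) := by exact_mod_cast hdet
    simp only [hy, hr, ← hQR, hD] at hden0 ⊢
    rw [pow_add] at hdetR
    field_simp
    linear_combination -hdetR
  rw [← hQR] at hden0 hden1 hden2 hsm
  rw [hyU] at h₁ h₂ hy1 hyb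
  rw [div_lt_one hden0] at hy1
  rw [div_lt_div_iff₀ (by linarith) hden0, one_mul] at hyb
  have hUpos : (0 : ℝ) < U := by
    by_contra! hle
    nlinarith
  have hrel : r l = (b : ℝ) ^ l / Q := by simp only [hr, hQR]
  refine exists_viable_of_two_shifts b hb (by rcases h.sign with rfl | rfl <;> simp)
    (by exact_mod_cast hUpos) (by exact_mod_cast hy1) ?_ hdet
    (by exact_mod_cast hden1) (by exact_mod_cast hden2) hd ?_ hi
    (fun m w => hc l hl u Q hQ m w) h₁ h₂
  · have : (Q : ℝ) < b * U := by linarith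
    exact_mod_cast this
  · refine lt_of_le_of_lt ?_ hsm
    rw [hrel, pow_add, div_le_div_iff₀ (by positivity) hden0]
    have h1 : (b : ℝ) ^ e * ((b : ℝ) ^ l / Q) * b * (U * Q)
        = (b : ℝ) ^ e * (b : ℝ) ^ l * (U * b) := by field_simp
    rw [h1]
    exact mul_le_mul_of_nonneg_left hyb.le (by positivity)

/-- Value of the continued fraction `[0; a₁, …, aₙ + t]`. -/
noncomputable def cfValWith : List ℕ → ℝ → ℝ
  | [], t => t
  | (h :: l), t => 1 / ((h : ℝ) + cfValWith l t)

theorem cfValWith_zero (L : List ℕ) : cfValWith L 0 = cfVal L := by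
  induction L with
  | nil => rfl
  | cons h l ih => simp [cfValWith, cfVal, ih]

theorem cfValWith_append (L : List ℕ) (a : ℕ) (t : ℝ) :
    cfValWith (L ++ [a]) t = cfValWith L (1 / (a + t)) := by
  induction L with
  | nil => rfl
  | cons h l ih => simp [cfValWith, ih]

/-- The integer whose base-`b` digit string is the concatenation of those of the entries. -/
def concatVal (b : ℕ) (L : List ℕ) : ℕ := L.foldl (fun N a => N * b ^ digLen b a + a) 0

/-- The total number of base-`b` digits of the entries. -/
def totalLen (b : ℕ) (L : List ℕ) : ℕ := (L.map (digLen b)).sum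

theorem concatVal_append (b : ℕ) (L : List ℕ) (a : ℕ) :
    concatVal b (L ++ [a]) = concatVal b L * b ^ digLen b a + a := by
  simp [concatVal]

theorem totalLen_append (b : ℕ) (L : List ℕ) (a : ℕ) :
    totalLen b (L ++ [a]) = totalLen b L + digLen b a := by
  simp [totalLen]

theorem digLen_eq (b : ℕ) (hb : 2 ≤ b) (a l : ℕ) (h1 : b ^ l ≤ a) (h2 : a < b ^ (l + 1)) :
    digLen b a = l + 1 := by
  have hlt : digLen b a ≤ l + 1 := (Nat.digits_length_le_iff (by omega) a).mpr h2
  have hge : l < digLen b a := (Nat.lt_digits_length_iff (by omega) a).mpr h1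
  omega

/-- The closed interval of reals whose base-`b` expansion starts with the digits of `L`. -/
def digitInterval (b : ℕ) (L : List ℕ) : Set ℝ :=
  Set.Icc ((concatVal b L : ℝ) / (b : ℝ) ^ totalLen b L)
    (((concatVal b L : ℝ) + 1) / (b : ℝ) ^ totalLen b L)

/-- A finite string of partial quotients that can be prolonged to a Trott number. -/
def Admissible (b : ℕ) (L : List ℕ) : Prop :=
  (∀ a ∈ L, 0 < a) ∧ ∃ p pm q qm ε κ : ℤ,
    0 ≤ qm ∧ (∀ t : ℝ, 0 ≤ t → cfValWith L t = (p + pm * t) / (q + qm * t)) ∧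
    Viable b q qm ((b : ℤ) ^ totalLen b L * p - concatVal b L * q)
      ((b : ℤ) ^ totalLen b L * pm - concatVal b L * qm) ε κ (totalLen b L)

theorem Admissible.cfVal_mem {b : ℕ} (hb : 2 ≤ b) {L : List ℕ} (h : Admissible b L) :
    cfVal L ∈ digitInterval b L := by
  obtain ⟨-, p, pm, q, qm, ε, κ, hqm, hcf, hv⟩ := h
  have hval : cfVal L = p / q := by simpa [cfValWith_zero] using hcf 0 le_rfl
  have hq : (0 : ℝ) < q := by exact_mod_cast hv.q_pos
  have hb0 : (0 : ℝ) < b := by exact_mod_cast (by omega : 0 < b)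
  have h1 : (0 : ℝ) < (b : ℝ) ^ totalLen b L * p - concatVal b L * q := by exact_mod_cast hv.u_pos
  have h2 : (b : ℝ) ^ totalLen b L * p - concatVal b L * q ≤ q := by exact_mod_cast hv.u_le
  rw [hval]
  constructor
  · rw [div_le_div_iff₀ (by positivity) hq]; linarith
  · rw [div_le_div_iff₀ hq (by positivity)]; linarith

/-- The partial quotient determined by a viable state and a large number `l` of digits. -/
theorem Viable.eventually_exists_quotient {b : ℕ} (hb : 2 ≤ b) {q qm u um ε κ : ℤ} {e : ℕ}
    (h : Viable b q qm u um ε κ e) :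
    ∀ᶠ l in atTop, q ∣ (b : ℤ) ^ l * u - κ →
      ∃ a : ℕ, 0 < a ∧ digLen b a = l ∧ (a : ℤ) * q = (b : ℤ) ^ l * u - κ := by
  have hbz : (2 : ℤ) ≤ b := by exact_mod_cast hb
  have hpow : Tendsto (fun l : ℕ => (b : ℤ) ^ l) atTop atTop :=
    tendsto_pow_atTop_atTop_of_one_lt (by linarith)
  filter_upwards [hpow.eventually_gt_atTop |κ|, hpow.eventually_gt_atTop |b * κ|,
    eventually_ge_atTop 1] with l h1 h2 hl hdvd
  have hq := h.q_pos
  obtain ⟨l, rfl⟩ := Nat.exists_eq_add_of_le' hl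
  obtain ⟨a, ha⟩ := hdvd
  rw [abs_lt] at h1 h2
  have hp : (0 : ℤ) < (b : ℤ) ^ l := by positivity
  have hlow : (b : ℤ) ^ l ≤ a := by
    have hgap := h.q_lt
    have : (b : ℤ) * ((b : ℤ) ^ l * q) ≤ b * (a * q) := by
      have e1 : (b : ℤ) * (a * q) = b ^ (l + 1) * (b * u) - b * κ := by
        rw [mul_comm a, ← ha]; ring
      have e2 : (b : ℤ) * ((b : ℤ) ^ l * q) = b ^ (l + 1) * q := by ring
      rw [e1, e2]
      nlinarith
    have := le_of_mul_le_mul_left this (by linarith)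
    exact le_of_mul_le_mul_right this hq
  have hhigh : a < (b : ℤ) ^ (l + 1) := by
    refine lt_of_mul_lt_mul_right (a := q) ?_ hq.le
    rw [mul_comm a, ← ha]
    have hle := h.u_le
    rcases h.u_lt_or with hu | hk
    · nlinarith
    · nlinarith
  lift a to ℕ using by linarith
  refine ⟨a, by exact_mod_cast hp.trans_le hlow, digLen_eq b hb a l (by exact_mod_cast hlow)
    (by exact_mod_cast hhigh), by rw [ha]; ring⟩

theorem Admissible.extend {b : ℕ} (hb : 2 ≤ b) {L : List ℕ} (h : Admissible b L) (z : ℝ) :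
    ∃ a : ℕ, Admissible b (L ++ [a]) ∧ cfVal (L ++ [a]) ≠ cfVal L ∧
      (z ≠ cfVal L → z ∉ digitInterval b (L ++ [a])) := by
  obtain ⟨hpos, p, pm, q, qm, ε, κ, hqm, hcf, hv⟩ := h
  have hval : cfVal L = p / q := by simpa [cfValWith_zero] using hcf 0 le_rfl
  have hq : (0 : ℝ) < q := by exact_mod_cast hv.q_pos
  have hqmR : (0 : ℝ) ≤ qm := by exact_mod_cast hqm
  have hb' : (2 : ℝ) ≤ b := by exact_mod_cast hb
  set s := totalLen b L with hs
  set N := concatVal b L with hN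
  have hfar : ∀ᶠ l : ℕ in atTop, z ≠ p / q →
      |(κ : ℝ)| + q < (b : ℝ) ^ l * (|z - p / q| * ((b : ℝ) ^ s * q)) := by
    by_cases hz : z = p / q
    · simp [hz]
    · have : 0 < |z - p / q| := abs_pos.mpr (sub_ne_zero.mpr hz)
      have t := (tendsto_pow_atTop_atTop_of_one_lt (by linarith : (1 : ℝ) < b)).atTop_mul_const
        (by positivity : 0 < |z - p / q| * ((b : ℝ) ^ s * q))
      filter_upwards [t.eventually_gt_atTop (|(κ : ℝ)| + q)] with l hl _ using hl
  obtain ⟨l, hdvd, hquot, hstep, hfar⟩ := (hv.freq.and_eventually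
    ((hv.eventually_exists_quotient hb).and ((hv.step hb).and hfar))).exists
  obtain ⟨a, ha0, hdig, ha⟩ := hquot hdvd
  obtain ⟨κ', hv'⟩ := hstep a ha
  have haR : (a : ℝ) * q = (b : ℝ) ^ l * ((b : ℝ) ^ s * p - N * q) - κ := by exact_mod_cast ha
  have ha0R : (0 : ℝ) < a := by exact_mod_cast ha0
  have hcf' : ∀ t : ℝ, 0 ≤ t → cfValWith (L ++ [a]) t
      = ((a * p + pm : ℤ) + (p : ℝ) * t) / ((a * q + qm : ℤ) + (q : ℝ) * t) := by
    intro t ht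
    rw [cfValWith_append, hcf _ (by positivity)]
    have h1 : (0 : ℝ) < a + t := by linarith
    have h2 : (0 : ℝ) < q + qm * (1 / (a + t)) := by positivity
    have h3 : (0 : ℝ) < (a * q + qm : ℤ) + (q : ℝ) * t := by push_cast; positivity
    rw [div_eq_div_iff h2.ne' h3.ne']
    push_cast
    field_simp
    ring
  refine ⟨a, ⟨?_, a * p + pm, p, a * q + qm, q, -ε, κ', hv.q_pos.le, hcf', ?_⟩, ?_, ?_⟩
  · intro x hx
    rcases List.mem_append.mp hx with hx | hx
    · exact hpos x hx
    · rwa [List.mem_singleton.mp hx]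
  · rw [totalLen_append, concatVal_append, hdig]
    convert hv' using 1
    · push_cast
      rw [pow_add]
      linear_combination (-(a : ℤ)) * ha
    · push_cast
      rw [pow_add]
      linear_combination -ha
  · have hval' : cfVal (L ++ [a]) = (a * p + pm : ℤ) / (a * q + qm : ℤ) := by
      simpa [cfValWith_zero] using hcf' 0 le_rfl
    rw [hval, hval']
    intro heq
    have hQ : (0 : ℝ) < (a * q + qm : ℤ) := by push_cast; positivity
    rw [div_eq_div_iff hQ.ne' hq.ne'] at heq
    have heqZ : (a * p + pm) * q = p * (a * q + qm) := by exact_mod_cast heq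
    have hdet := hv.det
    have hzero : ε * (b : ℤ) ^ s = 0 := by
      rw [← hdet]; linear_combination (-(b : ℤ) ^ s) * heqZ
    have hbs : (b : ℤ) ^ s ≠ 0 := by
      have : (b : ℤ) ≠ 0 := by exact_mod_cast (by omega : b ≠ 0)
      positivity
    rcases hv.sign with rfl | rfl <;> simp_all
  · intro hz hmem
    rw [hval] at hz
    specialize hfar hz
    have hbl : (0 : ℝ) < (b : ℝ) ^ l := by positivity
    have hbs : (0 : ℝ) < (b : ℝ) ^ s := by positivity
    rw [digitInterval, totalLen_append, concatVal_append, hdig, ← hs, ← hN, Set.mem_Icc,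
      div_le_iff₀ (by positivity), le_div_iff₀ (by positivity), pow_add] at hmem
    obtain ⟨m1, m2⟩ := hmem
    push_cast at m1 m2
    have key : |(z - p / q) * ((b : ℝ) ^ l * ((b : ℝ) ^ s * q))| ≤ |(κ : ℝ)| + q := by
      have e1 : (z - p / q) * ((b : ℝ) ^ l * ((b : ℝ) ^ s * q))
          = (z * ((b : ℝ) ^ s * (b : ℝ) ^ l) - (N * (b : ℝ) ^ l + a)) * q - κ := by
        field_simp
        linear_combination haR
      have hk1 := neg_abs_le (κ : ℝ)
      have hk2 := le_abs_self (κ : ℝ)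
      rw [e1, abs_le]
      constructor <;> nlinarith
    rw [abs_mul, abs_of_pos (by positivity : 0 < (b : ℝ) ^ l * ((b : ℝ) ^ s * q))] at key
    linarith

theorem admissible_singleton (K j : ℕ) (hj : 1 ≤ j) (hjK : j ≤ K) :
    Admissible (K ^ 2 + j) [K] := by
  have hK : 1 ≤ K := hj.trans hjK
  have hb : 2 ≤ K ^ 2 + j := by nlinarith
  have hKb : K < K ^ 2 + j := by nlinarith
  have hlen : digLen (K ^ 2 + j) K = 1 :=
    digLen_eq _ hb K 0 (by simpa using hK) (by simpa using hKb)
  have hs : totalLen (K ^ 2 + j) [K] = 1 := by simp [totalLen, hlen]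
  have hN : concatVal (K ^ 2 + j) [K] = K := by simp [concatVal]
  obtain ⟨r, hr⟩ : ∃ r : ℤ, ∃ᶠ l in atTop, (K : ℤ) ∣ ((K ^ 2 + j : ℕ) : ℤ) ^ l * j - r := by
    have : NeZero K := ⟨by omega⟩
    obtain ⟨x, hx⟩ := Finite.exists_infinite_fiber
      (fun l : ℕ => (((K ^ 2 + j : ℕ) : ZMod K)) ^ l * j)
    refine ⟨x.val, (Nat.frequently_atTop_iff_infinite.mpr (Set.infinite_coe_iff.mp hx)).mono ?_⟩
    intro l hl
    rw [← ZMod.intCast_zmod_eq_zero_iff_dvd]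
    have hl' : (((K ^ 2 + j : ℕ) : ZMod K)) ^ l * j = x := hl
    push_cast at hl' ⊢
    rw [hl']
    simp
  have hjKpos : (0 : ℤ) < j * K := by positivity
  obtain ⟨κ, hκr, hκ1, hκ2⟩ : ∃ κ : ℤ, (K : ℤ) ∣ r - κ ∧ (K ^ 2 + j : ℤ) < κ * j ∧
      κ * j ≤ K ^ 2 + j + j * K := by
    set t := ((K ^ 2 + j : ℤ) - r * j) / (j * K) with ht
    have h1 := Int.mul_ediv_add_emod ((K ^ 2 + j : ℤ) - r * j) (j * K)
    have h2 := Int.emod_nonneg ((K ^ 2 + j : ℤ) - r * j) hjKpos.ne'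
    have h3 := Int.emod_lt_of_pos ((K ^ 2 + j : ℤ) - r * j) hjKpos
    rw [← ht] at h1
    refine ⟨r + K * (t + 1), ⟨-(t + 1), by ring⟩, ?_, ?_⟩ <;> nlinarith
  have hKz : (1 : ℤ) ≤ K := by exact_mod_cast hK
  have hjz : (1 : ℤ) ≤ j := by exact_mod_cast hj
  have hjKz : (j : ℤ) ≤ K := by exact_mod_cast hjK
  have hκgt : 1 < κ := by
    by_contra! hle
    nlinarith
  have hjR : (0 : ℝ) < j := by exact_mod_cast hj
  have hKR : (0 : ℝ) < K := by exact_mod_cast hK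
  have hjKR : (j : ℝ) ≤ K := by exact_mod_cast hjK
  have hY : ((κ : ℝ) - ((1 : ℤ) : ℝ) * ((K ^ 2 + j : ℕ) : ℝ) ^ 1 / ((j : ℤ) : ℝ)) / ((K : ℤ) : ℝ)
      = (κ * j - (K ^ 2 + j)) / (j * K) := by
    push_cast; field_simp
  refine ⟨by simpa using Nat.pos_of_ne_zero (by omega : K ≠ 0), 1, 0, K, 1, 1, κ, by norm_num, ?_, ?_⟩
  · intro t _
    simp [cfValWith]
  · rw [hs, hN]
    have e1 : ((K ^ 2 + j : ℕ) : ℤ) ^ 1 * 1 - K * K = j := by push_cast; ring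
    rw [e1]
    refine ⟨Or.inl rfl, by omega, by omega, hjKz, ?_, Or.inr (by omega), ?_, hκgt.ne, ?_, ?_,
      Or.inr (by omega), ?_⟩
    · push_cast; nlinarith
    · push_cast; ring
    · have h1 : (K ^ 2 + j : ℝ) + 1 ≤ κ * j := by exact_mod_cast hκ1
      rw [hY, div_lt_div_iff₀ (by positivity) (by positivity)]
      push_cast
      nlinarith
    · have h1 : (κ : ℝ) * j ≤ K ^ 2 + j + j * K := by exact_mod_cast hκ2
      rw [hY, div_le_one (by positivity)]
      linarith
    · refine hr.mono fun l hl => ?_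
      have := hl.add hκr
      simpa using this

theorem admissible_three : Admissible 3 [1, 1] := by
  have hlen : digLen 3 1 = 1 := by simp [digLen]
  have hs : totalLen 3 [1, 1] = 2 := by simp [totalLen, hlen]
  have hN : concatVal 3 [1, 1] = 4 := by simp [concatVal, hlen]
  refine ⟨by simp, 1, 1, 2, 1, -1, -7, by norm_num, ?_, ?_⟩
  · intro t ht
    simp only [cfValWith]
    push_cast
    have h1 : (0 : ℝ) < 1 + t := by linarith
    have h2 : (0 : ℝ) < 2 + 1 * t := by linarith
    have h3 : (0 : ℝ) < 1 + 1 / (1 + t) := by positivity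
    rw [div_eq_div_iff h3.ne' h2.ne']
    field_simp
    ring
  · rw [hs, hN]
    refine ⟨Or.inr rfl, by norm_num, by norm_num, by norm_num, by norm_num, Or.inl (by norm_num),
      by norm_num, by norm_num, by norm_num, by norm_num, Or.inr (by norm_num), ?_⟩
    refine Frequently.of_forall fun l => ?_
    have h : Odd ((3 : ℤ) ^ l) := Odd.pow (by decide)
    obtain ⟨m, hm⟩ := h
    refine ⟨m + 4, ?_⟩
    push_cast
    rw [hm]; ring

theorem lt_pow_digLen (b : ℕ) (hb : 2 ≤ b) (a : ℕ) : a < b ^ digLen b a :=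
  Nat.lt_base_pow_length_digits (by omega)

theorem one_le_digLen (b a : ℕ) (ha : 0 < a) : 1 ≤ digLen b a :=
  List.length_pos_iff.mpr (Nat.digits_ne_nil_iff_ne_zero.mpr ha.ne')

theorem digitInterval_append_subset (b : ℕ) (hb : 2 ≤ b) (L : List ℕ) (a : ℕ) :
    digitInterval b (L ++ [a]) ⊆ digitInterval b L := by
  have hb0 : (0 : ℝ) < b := by exact_mod_cast (by omega : 0 < b)
  have ha : (a : ℝ) + 1 ≤ (b : ℝ) ^ digLen b a := by exact_mod_cast lt_pow_digLen b hb a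
  have hp : (0 : ℝ) < (b : ℝ) ^ digLen b a := by positivity
  have hq : (0 : ℝ) < (b : ℝ) ^ totalLen b L := by positivity
  rw [digitInterval, digitInterval, concatVal_append, totalLen_append, pow_add]
  apply Set.Icc_subset_Icc
  · rw [div_le_div_iff₀ hq (by positivity)]
    push_cast
    have : (0 : ℝ) ≤ a * (b : ℝ) ^ totalLen b L := by positivity
    linarith
  · rw [div_le_div_iff₀ (by positivity) hq]
    push_cast
    nlinarith

/-- If all sufficiently long convergents lie in the corresponding digit intervals, then the
partial quotients define a Trott number. -/
theorem exists_isTrottWith (b : ℕ) (hb : 2 ≤ b) (a : ℕ → ℕ) (n₀ : ℕ) (hpos : ∀ i, 0 < a i)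
    (h : ∀ n ≥ n₀, cfVal ((List.range n).map a) ∈ digitInterval b ((List.range n).map a)) :
    ∃ x, IsTrottWith b x a ∧ ∀ n, x ∈ digitInterval b ((List.range n).map a) := by
  have hb' : (2 : ℝ) ≤ b := by exact_mod_cast hb
  have hsucc : ∀ n, (List.range (n + 1)).map a = (List.range n).map a ++ [a n] := fun n => by
    rw [List.range_succ, List.map_append, List.map_singleton]
  set P : ℕ → List ℕ := fun n => (List.range n).map a with hP
  have htotal : ∀ n, totalLen b (P n) = ∑ j ∈ Finset.range n, digLen b (a j) := by
    intro n
    induction n with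
    | zero => simp [hP, totalLen]
    | succ n ih => rw [Finset.sum_range_succ, ← ih, ← totalLen_append]; simp only [hP, hsucc]
  set f : ℕ → ℝ := fun i =>
    (a i : ℝ) / (b : ℝ) ^ (∑ j ∈ Finset.range (i + 1), digLen b (a j)) with hf
  have hsum : ∀ n, ∑ i ∈ Finset.range n, f i
      = (concatVal b (P n) : ℝ) / (b : ℝ) ^ totalLen b (P n) := by
    intro n
    induction n with
    | zero => simp [hP, concatVal]
    | succ n ih =>
      have hPs : P (n + 1) = P n ++ [a n] := hsucc n
      rw [Finset.sum_range_succ, ih, hf]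
      simp only [← htotal]
      rw [hPs, concatVal_append, totalLen_append, pow_add]
      push_cast
      field_simp
  have hanti : Antitone fun n => digitInterval b (P n) :=
    antitone_nat_of_succ_le fun n => by
      have hPs : P (n + 1) = P n ++ [a n] := hsucc n
      simp only [hPs]
      exact digitInterval_append_subset b hb _ _
  have hleft : ∀ n, ∑ i ∈ Finset.range n, f i ∈ digitInterval b (P n) := by
    intro n
    rw [hsum]
    exact ⟨le_rfl, by gcongr; linarith⟩
  have hsummable : Summable f := by
    refine summable_of_sum_range_le (c := 1) (fun i => by positivity) fun n => ?_
    have := (hanti (Nat.zero_le n) (hleft n)).2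
    simpa [hP, concatVal, totalLen] using this
  have htend := hsummable.hasSum.tendsto_sum_nat
  have hmem : ∀ n, ∑' i, f i ∈ digitInterval b (P n) := fun n =>
    isClosed_Icc.mem_of_tendsto htend (by
      filter_upwards [eventually_ge_atTop n] with m hm using hanti hm (hleft m))
  refine ⟨∑' i, f i, ⟨hpos, ?_, rfl⟩, hmem⟩
  have hlen : ∀ n, n ≤ totalLen b (P n) := by
    intro n
    rw [htotal]
    simpa using Finset.card_nsmul_le_sum (Finset.range n) (fun j => digLen b (a j)) 1
      fun j _ => one_le_digLen b _ (hpos j)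
  rw [tendsto_iff_dist_tendsto_zero]
  refine squeeze_zero' (Eventually.of_forall fun _ => dist_nonneg) ?_
    (tendsto_pow_atTop_nhds_zero_of_lt_one (r := 1 / (b : ℝ)) (by positivity)
      (by rw [div_lt_one (by linarith)]; linarith))
  filter_upwards [eventually_ge_atTop n₀] with n hn
  refine (Real.dist_le_of_mem_Icc (h n hn) (hmem n)).trans ?_
  rw [← sub_div, add_sub_cancel_left, one_div_pow]
  exact one_div_le_one_div_of_le (by positivity) (pow_le_pow_right₀ (by linarith) (hlen n))

/-- A nested chain of lists, each obtained by appending one entry, is the chain of initial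
segments of a sequence. -/
theorem exists_seq_of_append_chain (L : ℕ → List ℕ) (x : ℕ → ℕ)
    (hsucc : ∀ n, L (n + 1) = L n ++ [x n]) :
    ∃ a : ℕ → ℕ, ∀ n, (List.range ((L 0).length + n)).map a = L n := by
  refine ⟨fun i => if h : i < (L 0).length then (L 0)[i] else x (i - (L 0).length), fun n => ?_⟩
  induction n with
  | zero =>
    apply List.ext_getElem
    · simp
    · intro i h1 h2
      simp [h2]
  | succ n ih => rw [← add_assoc, List.range_succ, List.map_append, ih, hsucc]; simp

theorem not_countable_of_admissible (b : ℕ) (hb : 2 ≤ b) (L₀ : List ℕ)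
    (h₀ : Admissible b L₀) : ¬ (TrottSet b).Countable := by
  intro hcount
  obtain ⟨z, hz⟩ := Set.countable_iff_exists_subset_range.mp hcount
  choose x hadm hne havoid using
    fun (n : ℕ) (S : {L // Admissible b L}) => S.2.extend hb (z (n / 2))
  let S : ℕ → {L // Admissible b L} :=
    fun n => Nat.rec ⟨L₀, h₀⟩ (fun n S => ⟨S.1 ++ [x n S], hadm n S⟩) n
  have hS : ∀ n, (S (n + 1)).1 = (S n).1 ++ [x n (S n)] := fun n => rfl
  obtain ⟨a, ha⟩ := exists_seq_of_append_chain (fun n => (S n).1) (fun n => x n (S n)) hS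
  have hpos : ∀ i, 0 < a i := fun i => by
    refine (S (i + 1)).2.1 (a i) ?_
    rw [← ha (i + 1)]
    exact List.mem_map_of_mem (List.mem_range.mpr (by omega))
  obtain ⟨y, hy, hmem⟩ := exists_isTrottWith b hb a L₀.length hpos fun n hn => by
    obtain ⟨m, rfl⟩ := Nat.exists_eq_add_of_le hn
    have := ha m
    rw [show (S 0).1 = L₀ from rfl] at this
    rw [this]
    exact (S m).2.cfVal_mem hb
  obtain ⟨n, rfl⟩ := hz (show y ∈ TrottSet b from ⟨a, hy⟩)
  have hin : ∀ m, z n ∈ digitInterval b (S m).1 := fun m => ha m ▸ hmem _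
  have heq : ∀ m, m / 2 = n → z n = cfVal (S m).1 := by
    intro m hm
    by_contra hzne
    exact havoid m (S m) (by rwa [hm]) (by rw [hm]; exact hin (m + 1))
  exact hne (2 * n) (S (2 * n)) ((heq (2 * n + 1) (by omega)).symm.trans (heq (2 * n) (by omega)))

/-- For `b ∈ Γ`, the set of Trott numbers in base `b` is uncountable. -/
theorem trottSet_uncountable (b : ℕ) (hb : 2 ≤ b) (hΓ : b ∈ Gamma) :
    ¬ (TrottSet b).Countable := by
  rcases hΓ with rfl | ⟨k, hk, h1, h2⟩
  · exact not_countable_of_admissible 3 hb _ admissible_three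
  · obtain ⟨j, rfl⟩ := Nat.exists_eq_add_of_le (show k ^ 2 ≤ b by omega)
    exact not_countable_of_admissible _ hb _ (admissible_singleton k j (by omega) (by omega))
end

section
/- Let b ≥ 2 be an integer with b ∈ Γ. Then the set T_b of Trott numbers in base b is a G_δ subset of the real line, i.e., T_b is a countable intersection of open sets. -/
open Filter Topology

/-- The open set of reals in `(0, 1)` whose first `n` continued fraction digits are
`a 0, …, a (n - 1)` and whose expansion does not stop before index `n`. -/
def cfCylinder : ℕ → (ℕ → ℕ) → Set ℝ
  | 0, _ => Set.Ioo 0 1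
  | n + 1, a => {x | x ∈ Set.Ioo (0 : ℝ) 1 ∧ x⁻¹ - (a 0 : ℝ) ∈ cfCylinder n (fun i => a (i + 1))}

/-- The number whose base-`b` digits are the concatenated digits of the `a i`. -/
noncomputable def digitSum (b : ℕ) (a : ℕ → ℕ) : ℝ :=
  ∑' i : ℕ, (a i : ℝ) / (b : ℝ) ^ (∑ j ∈ Finset.range (i + 1), digLen b (a j))

lemma cfCylinder_subset (n : ℕ) (a : ℕ → ℕ) : cfCylinder n a ⊆ Set.Ioo 0 1 := by
  cases n with
  | zero => exact subset_rfl
  | succ n => exact fun x hx => hx.1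

lemma isOpen_cfCylinder (n : ℕ) (a : ℕ → ℕ) : IsOpen (cfCylinder n a) := by
  induction n generalizing a with
  | zero => exact isOpen_Ioo
  | succ n ih =>
    have hcont : ContinuousOn (fun x : ℝ => x⁻¹ - (a 0 : ℝ)) (Set.Ioo 0 1) :=
      (continuousOn_id.inv₀ fun x hx => hx.1.ne').sub continuousOn_const
    exact hcont.isOpen_inter_preimage isOpen_Ioo (ih _)

lemma first_digit_eq_of_mem_cfCylinder {n m : ℕ} {a a' : ℕ → ℕ} {x : ℝ}
    (hx : x ∈ cfCylinder (n + 1) a) (hx' : x ∈ cfCylinder (m + 1) a') : a 0 = a' 0 := by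
  have h := cfCylinder_subset _ _ hx.2
  have h' := cfCylinder_subset _ _ hx'.2
  have h1 : (a 0 : ℝ) < a' 0 + 1 := by linarith [h.1, h'.2]
  have h2 : (a' 0 : ℝ) < a 0 + 1 := by linarith [h'.1, h.2]
  norm_cast at h1 h2
  omega

lemma digit_eq_of_mem_cfCylinder {i n m : ℕ} {a a' : ℕ → ℕ} {x : ℝ} (hn : i < n) (hm : i < m)
    (hx : x ∈ cfCylinder n a) (hx' : x ∈ cfCylinder m a') : a i = a' i := by
  induction i generalizing n m a a' x with
  | zero =>
    obtain ⟨n, rfl⟩ := Nat.exists_eq_succ_of_ne_zero hn.ne'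
    obtain ⟨m, rfl⟩ := Nat.exists_eq_succ_of_ne_zero hm.ne'
    exact first_digit_eq_of_mem_cfCylinder hx hx'
  | succ i ih =>
    obtain ⟨n, rfl⟩ := Nat.exists_eq_succ_of_ne_zero (Nat.ne_zero_of_lt hn)
    obtain ⟨m, rfl⟩ := Nat.exists_eq_succ_of_ne_zero (Nat.ne_zero_of_lt hm)
    have htail := hx'.2
    rw [← first_digit_eq_of_mem_cfCylinder hx hx'] at htail
    exact ih (Nat.succ_lt_succ_iff.1 hn) (Nat.succ_lt_succ_iff.1 hm) hx.2 htail

lemma cfCylinder_congr {n : ℕ} {a a' : ℕ → ℕ} (h : ∀ i < n, a i = a' i) :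
    cfCylinder n a = cfCylinder n a' := by
  induction n generalizing a a' with
  | zero => rfl
  | succ n ih =>
    simp only [cfCylinder, h 0 n.succ_pos,
      ih (a := fun i => a (i + 1)) (a' := fun i => a' (i + 1)) fun i hi => h (i + 1) (by omega)]

lemma cfVal_range_succ (a : ℕ → ℕ) (n : ℕ) :
    cfVal ((List.range (n + 1)).map a) =
      1 / ((a 0 : ℝ) + cfVal ((List.range n).map fun i => a (i + 1))) := by
  rw [List.range_succ_eq_map, List.map_cons, List.map_map]
  rfl

lemma cfVal_mem_Icc_s2 {a : ℕ → ℕ} (ha : ∀ i, 0 < a i) (n : ℕ) :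
    cfVal ((List.range n).map a) ∈ Set.Icc (0 : ℝ) 1 := by
  induction n generalizing a with
  | zero => simp [cfVal]
  | succ n ih =>
    rw [cfVal_range_succ]
    have h := ih (a := fun i => a (i + 1)) fun i => ha _
    have h0 : (1 : ℝ) ≤ a 0 := by exact_mod_cast ha 0
    have h1 : (1 : ℝ) ≤ a 0 + cfVal ((List.range n).map fun i => a (i + 1)) := by linarith [h.1]
    exact ⟨by positivity, by rw [div_le_one (by linarith)]; exact h1⟩

lemma pos_of_tendsto_cfVal {a : ℕ → ℕ} (ha : ∀ i, 0 < a i) {x : ℝ}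
    (hx : Tendsto (fun n => cfVal ((List.range n).map a)) atTop (𝓝 x)) : 0 < x := by
  have h0 : (0 : ℝ) < 1 / ((a 0 : ℝ) + 1) := by positivity
  refine h0.trans_le (ge_of_tendsto' ((tendsto_add_atTop_iff_nat 1).2 hx) fun n => ?_)
  rw [cfVal_range_succ]
  have h := cfVal_mem_Icc_s2 (a := fun i => a (i + 1)) (fun i => ha _) n
  have h1 : (0 : ℝ) < a 0 := by exact_mod_cast ha 0
  exact one_div_le_one_div_of_le (by linarith [h.1]) (by linarith [h.2])

lemma tendsto_cfVal_shift {a : ℕ → ℕ} (ha : ∀ i, 0 < a i) {x : ℝ}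
    (hx : Tendsto (fun n => cfVal ((List.range n).map a)) atTop (𝓝 x)) :
    Tendsto (fun n => cfVal ((List.range n).map fun i => a (i + 1))) atTop
      (𝓝 (x⁻¹ - (a 0 : ℝ))) := by
  have h := (((tendsto_add_atTop_iff_nat 1).2 hx).inv₀
    (pos_of_tendsto_cfVal ha hx).ne').sub_const (a 0 : ℝ)
  refine h.congr fun n => ?_
  rw [cfVal_range_succ]
  simp

lemma mem_cfCylinder_of_tendsto {a : ℕ → ℕ} (ha : ∀ i, 0 < a i) {x : ℝ}
    (hx : Tendsto (fun n => cfVal ((List.range n).map a)) atTop (𝓝 x)) (n : ℕ) :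
    x ∈ cfCylinder n a := by
  induction n generalizing a x with
  | zero =>
    have hpos := pos_of_tendsto_cfVal ha hx
    have h := pos_of_tendsto_cfVal (fun i => ha (i + 1)) (tendsto_cfVal_shift ha hx)
    have h1 : (1 : ℝ) ≤ a 0 := by exact_mod_cast ha 0
    exact ⟨hpos, (one_lt_inv₀ hpos).1 (by linarith)⟩
  | succ n ih =>
    exact ⟨cfCylinder_subset _ _ (ih ha hx), ih (fun i => ha (i + 1)) (tendsto_cfVal_shift ha hx)⟩

/-- Two continued fraction steps contract distances by a factor of at least four. -/
lemma abs_sub_two_step_le {p q s t : ℝ} (hp : 1 ≤ p) (hq : 1 ≤ q) (hs : 0 ≤ s) (ht : 0 ≤ t) :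
    |1 / (p + 1 / (q + s)) - 1 / (p + 1 / (q + t))| ≤ |s - t| / 4 := by
  have hs2 : 2 ≤ p * (q + s) + 1 := by nlinarith
  have ht2 : 2 ≤ p * (q + t) + 1 := by nlinarith
  have hqs : q + s ≠ 0 := by positivity
  have hqt : q + t ≠ 0 := by positivity
  have h1 : p * (q + s) + 1 ≠ 0 := by positivity
  have h2 : p * (q + t) + 1 ≠ 0 := by positivity
  have key : 1 / (p + 1 / (q + s)) - 1 / (p + 1 / (q + t)) =
      (s - t) / ((p * (q + s) + 1) * (p * (q + t) + 1)) := by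
    have e : ∀ u : ℝ, u ≠ 0 → p * u + 1 ≠ 0 → 1 / (p + 1 / u) = u / (p * u + 1) := by
      intro u hu hu'
      rw [show p + 1 / u = (p * u + 1) / u by field_simp, one_div_div]
    rw [e _ hqs h1, e _ hqt h2, div_sub_div _ _ h1 h2]
    congr 1
    ring
  rw [key, abs_div, abs_of_pos (by positivity : 0 < (p * (q + s) + 1) * (p * (q + t) + 1))]
  exact div_le_div_of_nonneg_left (abs_nonneg _) (by norm_num) (by nlinarith)

lemma abs_cfVal_sub_le {a : ℕ → ℕ} (ha : ∀ i, 0 < a i) {x : ℝ} (n : ℕ)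
    (hx : x ∈ cfCylinder n a) :
    |cfVal ((List.range n).map a) - x| ≤ 2 * (1 / 2 : ℝ) ^ n := by
  induction n using Nat.twoStepInduction generalizing a x with
  | zero =>
    have h := cfCylinder_subset _ _ hx
    have h' := cfVal_mem_Icc_s2 ha 0
    rw [abs_le]
    constructor <;> linarith [h.1, h.2, h'.1, h'.2]
  | one =>
    have h := cfCylinder_subset _ _ hx
    have h' := cfVal_mem_Icc_s2 ha 1
    rw [abs_le]
    constructor <;> linarith [h.1, h.2, h'.1, h'.2]
  | more n ih _ =>
    obtain ⟨-, hy, hz⟩ := hx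
    have hzpos := (cfCylinder_subset _ _ hz).1
    have hzle := ih (a := fun i => a (i + 1 + 1)) (fun i => ha _) hz
    set y := x⁻¹ - (a 0 : ℝ) with hydef
    set z := y⁻¹ - (a (0 + 1) : ℝ) with hzdef
    have hx_eq : x = 1 / ((a 0 : ℝ) + 1 / ((a (0 + 1) : ℝ) + z)) := by
      simp [hydef, hzdef]
    rw [cfVal_range_succ, cfVal_range_succ, hx_eq]
    have hval := cfVal_mem_Icc_s2 (a := fun i => a (i + 1 + 1)) (fun i => ha _) n
    calc _ ≤ |cfVal ((List.range n).map fun i => a (i + 1 + 1)) - z| / 4 :=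
          abs_sub_two_step_le (by exact_mod_cast ha 0) (by exact_mod_cast ha _) hval.1 hzpos.le
      _ ≤ 2 * (1 / 2 : ℝ) ^ n / 4 := by gcongr
      _ = 2 * (1 / 2 : ℝ) ^ (n + 2) := by ring

lemma tendsto_cfVal_of_mem_cfCylinder {a : ℕ → ℕ} (ha : ∀ i, 0 < a i) {x : ℝ}
    (hx : ∀ n, x ∈ cfCylinder n a) :
    Tendsto (fun n => cfVal ((List.range n).map a)) atTop (𝓝 x) := by
  rw [tendsto_iff_norm_sub_tendsto_zero]
  refine squeeze_zero (fun _ => norm_nonneg _) (fun n => abs_cfVal_sub_le ha n (hx n)) ?_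
  simpa using (tendsto_pow_atTop_nhds_zero_of_lt_one (by norm_num : (0 : ℝ) ≤ 1 / 2)
    (by norm_num)).const_mul 2

lemma digitSum_term_le {b : ℕ} (hb : 2 ≤ b) {a : ℕ → ℕ} (ha : ∀ i, 0 < a i) (i : ℕ) :
    (a i : ℝ) / (b : ℝ) ^ (∑ j ∈ Finset.range (i + 1), digLen b (a j)) ≤ (1 / 2 : ℝ) ^ i := by
  have hb' : (2 : ℝ) ≤ b := by exact_mod_cast hb
  have hlt : (a i : ℝ) ≤ (b : ℝ) ^ digLen b (a i) := by
    exact_mod_cast (Nat.lt_base_pow_length_digits (m := a i) hb).le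
  have hlen : i ≤ ∑ j ∈ Finset.range i, digLen b (a j) := by
    have h : ∑ _j ∈ Finset.range i, 1 ≤ ∑ j ∈ Finset.range i, digLen b (a j) :=
      Finset.sum_le_sum fun j _ =>
        List.length_pos_iff.2 (Nat.digits_ne_nil_iff_ne_zero.2 (ha j).ne')
    simpa using h
  rw [Finset.sum_range_succ, pow_add, div_le_iff₀ (by positivity)]
  have h2 : (2 : ℝ) ^ i ≤ (b : ℝ) ^ ∑ j ∈ Finset.range i, digLen b (a j) :=
    (pow_le_pow_left₀ (by norm_num) hb' i).trans (pow_le_pow_right₀ (by linarith) hlen)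
  have h1 : 1 ≤ (1 / 2 : ℝ) ^ i * (b : ℝ) ^ ∑ j ∈ Finset.range i, digLen b (a j) := by
    calc (1 : ℝ) = (1 / 2 : ℝ) ^ i * 2 ^ i := by rw [← mul_pow]; norm_num
      _ ≤ _ := by gcongr
  rw [← mul_assoc]
  exact hlt.trans (le_mul_of_one_le_left (by positivity) h1)

/-- `digitSum` is continuous on sequences of positive integers, for pointwise convergence. -/
lemma tendsto_digitSum {b : ℕ} (hb : 2 ≤ b) {A : ℕ → ℕ → ℕ} {a : ℕ → ℕ}
    (hA : ∀ n i, 0 < A n i) (h : ∀ n, ∀ i < n, A n i = a i) :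
    Tendsto (fun n => digitSum b (A n)) atTop (𝓝 (digitSum b a)) := by
  refine tendsto_tsum_of_dominated_convergence
    (summable_geometric_of_lt_one (by norm_num : (0 : ℝ) ≤ 1 / 2) (by norm_num)) ?_ ?_
  · refine fun i => tendsto_const_nhds.congr' ?_
    filter_upwards [eventually_gt_atTop i] with n hn
    have hsum : ∑ j ∈ Finset.range (i + 1), digLen b (A n j) =
        ∑ j ∈ Finset.range (i + 1), digLen b (a j) :=
      Finset.sum_congr rfl fun j hj => by
        rw [h n j ((Nat.lt_succ_iff.1 (Finset.mem_range.1 hj)).trans_lt hn)]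
    rw [h n i hn, hsum]
  · refine Eventually.of_forall fun n i => ?_
    rw [Real.norm_of_nonneg (by positivity)]
    exact digitSum_term_le hb (hA n) i

lemma trottSet_eq_iInter {b : ℕ} (hb : 2 ≤ b) :
    TrottSet b = ⋂ n : ℕ, ⋃ a ∈ {a : ℕ → ℕ | ∀ i, 0 < a i},
      cfCylinder n a ∩ Metric.ball (digitSum b a) (1 / ((n : ℝ) + 1)) := by
  ext x
  simp only [Set.mem_iInter, Set.mem_iUnion, exists_prop]
  constructor
  · rintro ⟨a, ha, hcf, hsum⟩ n
    refine ⟨a, ha, mem_cfCylinder_of_tendsto ha hcf n, ?_⟩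
    rw [show digitSum b a = x from hsum.symm]
    exact Metric.mem_ball_self (by positivity)
  · intro hx
    choose A hpos hcyl hball using hx
    have hA : ∀ n, ∀ i < n, A n i = A (i + 1) i := fun n i hi =>
      digit_eq_of_mem_cfCylinder hi (Nat.lt_succ_self i) (hcyl n) (hcyl (i + 1))
    have ha : ∀ i, 0 < A (i + 1) i := fun i => hpos _ i
    refine ⟨fun i => A (i + 1) i, ha, tendsto_cfVal_of_mem_cfCylinder ha fun n => ?_, ?_⟩
    · rw [← cfCylinder_congr (hA n)]
      exact hcyl n
    · refine tendsto_nhds_unique ?_ (tendsto_digitSum hb hpos hA)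
      rw [tendsto_iff_dist_tendsto_zero]
      refine squeeze_zero (fun _ => dist_nonneg) (fun n => ?_) tendsto_one_div_add_atTop_nhds_zero_nat
      rw [dist_comm]
      exact (hball n).le

/-- For `b ∈ Γ`, the set of Trott numbers in base `b` is a `Gδ` subset of `ℝ`. -/
theorem trottSet_isGδ (b : ℕ) (hb : 2 ≤ b) (hΓ : b ∈ Gamma) :
    IsGδ (TrottSet b) := by
  rw [trottSet_eq_iInter hb]
  exact .iInter_of_isOpen fun n => isOpen_biUnion fun a _ =>
    (isOpen_cfCylinder n a).inter Metric.isOpen_ball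
end
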